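/- arXiv:1904.07985 — 3 statements merged into one kernel-verified Lean document; each statement's English description precedes it below -/
import Mathlib

section
/- There exists a universal constant C > 0 such that for any closed path P of length 2k on a graph G, if the subgraph G_P traversed by P is ℓ-tangle free with ℓ ≥ 2, then the total number of cycle meeting points in G_P is at most C|E_P|²/ℓ², where E_P is the edge set of G_P. -/
/-- An edge `e` of a graph `H` is a *cycle edge* if it belongs to some cycle of `H`. -/
def SimpleGraph.IsCycleEdge {V : Type*} (H : SimpleGraph V) (e : Sym2 V) : Prop :=
  ∃ (v : V) (c : H.Walk v v), c.IsCycle ∧ e ∈ c.edges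

/-- A graph is `ℓ`-*tangle free* if every radius-`ℓ` ball contains at most one cycle. -/
def SimpleGraph.TangleFree {V : Type*} (G : SimpleGraph V) (ℓ : ℕ) : Prop :=
  ∀ (v u₁ u₂ : V) (c₁ : G.Walk u₁ u₁) (c₂ : G.Walk u₂ u₂),
    c₁.IsCycle → c₂.IsCycle →
    (∀ x ∈ c₁.support, G.dist v x ≤ ℓ) → (∀ x ∈ c₂.support, G.dist v x ≤ ℓ) →
    (∀ e, e ∈ c₁.edges ↔ e ∈ c₂.edges)

/-- The subgraph `G_P` traversed by the first `m` steps of the path `P`. -/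
def pathGraph {V : Type*} (P : ℕ → V) (m : ℕ) : SimpleGraph V :=
  SimpleGraph.fromEdgeSet {e | ∃ t < m, e = s(P t, P (t + 1))}

/-- A vertex `v` is a *cycle meeting point* of `H` if there are at least three distinct
vertices `i, j, u` such that `v↔i`, `v↔j`, `v↔u` are all cycle edges of `H`. -/
def CycleMeetingPoint {V : Type*} (H : SimpleGraph V) (v : V) : Prop :=
  ∃ i j u : V, i ≠ j ∧ i ≠ u ∧ j ≠ u ∧
    H.IsCycleEdge s(v, i) ∧ H.IsCycleEdge s(v, j) ∧ H.IsCycleEdge s(v, u)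


/-- any two cycles have the same edges -/
def AtMostOneCycle {V : Type*} (K : SimpleGraph V) : Prop :=
  ∀ (u₁ u₂ : V) (c₁ : K.Walk u₁ u₁) (c₂ : K.Walk u₂ u₂), c₁.IsCycle → c₂.IsCycle →
    ∀ e, e ∈ c₁.edges → e ∈ c₂.edges

lemma acyclic_card {V : Type*} [Finite V] [Nonempty V] (K : SimpleGraph V) (h : K.IsAcyclic) :
    K.edgeSet.ncard + 1 ≤ Nat.card V := by
  classical
  have := Fintype.ofFinite V
  obtain ⟨T, hT, -, hTt⟩ := (SimpleGraph.connected_top (V := V)).exists_isTree_le_of_le_of_isAcyclic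
    le_top h
  have h1 := (SimpleGraph.isTree_iff_connected_and_card.1 hTt).2
  rw [← h1]
  have : K.edgeSet.ncard ≤ T.edgeSet.ncard :=
    Set.ncard_le_ncard (SimpleGraph.edgeSet_mono hT) (Set.toFinite _)
  rw [Nat.card_coe_set_eq]
  omega

lemma unicyclic_card {V : Type*} [Finite V] (K : SimpleGraph V) (h : AtMostOneCycle K) :
    K.edgeSet.ncard ≤ Nat.card V := by
  classical
  rcases isEmpty_or_nonempty V with hV | hV
  · have : K.edgeSet = ∅ := by
      ext e
      induction e with | _ x y => exact (hV.false x).elim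
    simp [this]
  by_cases hK : K.IsAcyclic
  · have := acyclic_card K hK
    omega
  · unfold SimpleGraph.IsAcyclic at hK
    push Not at hK
    obtain ⟨v, c, hc⟩ := hK
    obtain ⟨e, he⟩ : ∃ e, e ∈ c.edges := by
      have := hc.ne_nil
      cases c with
      | nil => exact absurd rfl this
      | cons h p => exact ⟨_, by simp; left; rfl⟩
    have hac : (K.deleteEdges {e}).IsAcyclic := by
      intro u d hd
      have h1 := h v u c (d.mapLe (SimpleGraph.deleteEdges_le {e})) hc (hd.mapLe _) e he
      rw [SimpleGraph.Walk.edges_mapLe_eq_edges] at h1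
      have h2 := d.edges_subset_edgeSet h1
      simp at h2
    have h1 := acyclic_card _ hac
    rw [SimpleGraph.edgeSet_deleteEdges] at h1
    have h2 := Set.ncard_sdiff_singleton_add_one (c.edges_subset_edgeSet he) (Set.toFinite K.edgeSet)
    omega

lemma unicyclic_card_on {V : Type*} [Finite V] (K : SimpleGraph V) (h : AtMostOneCycle K)
    (S : Set V) (hS : ∀ x y, K.Adj x y → x ∈ S) : K.edgeSet.ncard ≤ S.ncard := by
  classical
  have h1 : AtMostOneCycle (K.induce S) := by
    intro u₁ u₂ c₁ c₂ h₁ h₂ e he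
    have hinj : Function.Injective (SimpleGraph.Embedding.induce (G := K) S).toHom :=
      (SimpleGraph.Embedding.induce (G := K) S).injective
    have := h _ _ (c₁.map (SimpleGraph.Embedding.induce (G := K) S).toHom)
      (c₂.map (SimpleGraph.Embedding.induce (G := K) S).toHom) (h₁.map hinj) (h₂.map hinj)
      (Sym2.map (SimpleGraph.Embedding.induce (G := K) S).toHom e)
      (by rw [SimpleGraph.Walk.edges_map]; exact List.mem_map_of_mem he)
    rw [SimpleGraph.Walk.edges_map, List.mem_map] at this
    obtain ⟨e', he', heq⟩ := this
    rwa [← Sym2.map.injective hinj heq]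
  have h2 := unicyclic_card _ h1
  have h3 : K.edgeSet ⊆ Sym2.map (Subtype.val : S → V) '' (K.induce S).edgeSet := by
    intro e
    induction e with | _ x y =>
    intro he
    have he : K.Adj x y := he
    exact ⟨s(⟨x, hS x y he⟩, ⟨y, hS y x he.symm⟩), by simpa using he, by simp⟩
  calc _ ≤ _ := Set.ncard_le_ncard h3 (Set.toFinite _)
    _ ≤ _ := Set.ncard_image_le (Set.toFinite _)
    _ ≤ _ := h2
    _ = _ := by simp [Set.ncard]

lemma cycle_support_adj {V : Type*} {K : SimpleGraph V} {u x : V} (c : K.Walk u u)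
    (hc : c.IsCycle) (hx : x ∈ c.support) :
    ∃ y z, y ≠ z ∧ s(x, y) ∈ c.edges ∧ s(x, z) ∈ c.edges := by
  have h := hc.ncard_neighborSet_toSubgraph_eq_two hx
  obtain ⟨y, z, hyz, h⟩ := Set.ncard_eq_two.1 h
  refine ⟨y, z, hyz, ?_, ?_⟩
  · have : y ∈ c.toSubgraph.neighborSet x := by rw [h]; simp
    rw [← SimpleGraph.Walk.mem_edges_toSubgraph]
    exact this
  · have : z ∈ c.toSubgraph.neighborSet x := by rw [h]; simp
    rw [← SimpleGraph.Walk.mem_edges_toSubgraph]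
    exact this

lemma tangle_amo {V : Type*} {H K : SimpleGraph V} (hKH : K ≤ H) {ℓ : ℕ} (hT : H.TangleFree ℓ)
    (v : V) (hv : ∀ x y, K.Adj x y → H.dist v x ≤ ℓ) : AtMostOneCycle K := by
  intro u₁ u₂ c₁ c₂ h₁ h₂ e he
  have key : ∀ (u : V) (c : K.Walk u u), c.IsCycle →
      ∀ x ∈ (c.mapLe hKH).support, H.dist v x ≤ ℓ := by
    intro u c hc x hx
    have hx : x ∈ c.support := by simpa [SimpleGraph.Walk.mapLe] using hx
    obtain ⟨y, _, _, h, _⟩ := cycle_support_adj c hc hx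
    exact hv x y (c.edges_subset_edgeSet h)
  have := (hT v u₁ u₂ (c₁.mapLe hKH) (c₂.mapLe hKH) (h₁.mapLe _) (h₂.mapLe _)
    (key _ _ h₁) (key _ _ h₂) e).1 (by rwa [SimpleGraph.Walk.edges_mapLe_eq_edges])
  rwa [SimpleGraph.Walk.edges_mapLe_eq_edges] at this

/-- graph of cycle edges -/
def cycG {V : Type*} (H : SimpleGraph V) : SimpleGraph V where
  Adj x y := H.Adj x y ∧ H.IsCycleEdge s(x, y)
  symm := ⟨fun x y h => ⟨h.1.symm, by rw [Sym2.eq_swap]; exact h.2⟩⟩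
  loopless := ⟨fun x h => h.1.ne rfl⟩

lemma cycG_le {V : Type*} (H : SimpleGraph V) : cycG H ≤ H := fun _ _ h => h.1

lemma cycleEdge_adj {V : Type*} {H : SimpleGraph V} {x y : V} (h : H.IsCycleEdge s(x, y)) :
    (cycG H).Adj x y := by
  refine ⟨?_, h⟩
  obtain ⟨v, c, _, h⟩ := h
  exact c.edges_subset_edgeSet h

lemma meeting_count {V : Type*} [Fintype V] (H : SimpleGraph V) :
    {v | CycleMeetingPoint H v}.ncard + 2 * {v | ∃ w, (cycG H).Adj v w}.ncard
      ≤ 2 * (cycG H).edgeSet.ncard := by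
  classical
  have h1 := (cycG H).sum_degrees_eq_twice_card_edges
  have h2 : (cycG H).edgeSet.ncard = (cycG H).edgeFinset.card := by
    rw [← SimpleGraph.coe_edgeFinset, Set.ncard_coe_finset]
  rw [h2, ← h1]
  have h3 : {v | CycleMeetingPoint H v}.ncard
      = ∑ v : V, if CycleMeetingPoint H v then 1 else 0 := by
    rw [← Finset.card_filter, ← Set.ncard_coe_finset]; simp
  have h4 : {v | ∃ w, (cycG H).Adj v w}.ncard
      = ∑ v : V, if ∃ w, (cycG H).Adj v w then 1 else 0 := by
    rw [← Finset.card_filter, ← Set.ncard_coe_finset]; simp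
  rw [h3, h4, Finset.mul_sum, ← Finset.sum_add_distrib]
  refine Finset.sum_le_sum fun v _ => ?_
  by_cases hm : CycleMeetingPoint H v
  · obtain ⟨i, j, u, hij, hiu, hju, hi, hj, hu⟩ := hm
    have : ({i, j, u} : Finset V) ⊆ (cycG H).neighborFinset v := by
      intro x hx
      simp only [Finset.mem_insert, Finset.mem_singleton] at hx
      rw [SimpleGraph.mem_neighborFinset]
      rcases hx with rfl | rfl | rfl <;> exact cycleEdge_adj ‹_›
    have h5 := Finset.card_le_card this
    rw [Finset.card_eq_three.2 ⟨i, j, u, hij, hiu, hju, rfl⟩,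
      SimpleGraph.card_neighborFinset_eq_degree] at h5
    split_ifs <;> omega
  · by_cases hw : ∃ w, (cycG H).Adj v w
    · obtain ⟨w, hw'⟩ := hw
      obtain ⟨a, c, hc, he⟩ := hw'.2
      obtain ⟨y, z, hyz, hy, hz⟩ := cycle_support_adj c hc (c.fst_mem_support_of_mem_edges he)
      have : ({y, z} : Finset V) ⊆ (cycG H).neighborFinset v := by
        intro x hx
        simp only [Finset.mem_insert, Finset.mem_singleton] at hx
        rw [SimpleGraph.mem_neighborFinset]
        rcases hx with rfl | rfl 
        · exact cycleEdge_adj ⟨a, c, hc, hy⟩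
        · exact cycleEdge_adj ⟨a, c, hc, hz⟩
      have h5 := Finset.card_le_card this
      rw [Finset.card_pair hyz, SimpleGraph.card_neighborFinset_eq_degree] at h5
      rw [if_neg hm]
      split_ifs <;> omega
    · simp [hm, hw]

/-- part of `H` with both ends in `S` -/
def subG {V : Type*} (H : SimpleGraph V) (S : Set V) : SimpleGraph V where
  Adj x y := H.Adj x y ∧ x ∈ S ∧ y ∈ S
  symm := ⟨fun x y h => ⟨h.1.symm, h.2.2, h.2.1⟩⟩
  loopless := ⟨fun x h => h.1.ne rfl⟩

/-- edges between clusters -/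
def crossE {V : Type*} (H : SimpleGraph V) (f : V → V) (c c' : V) : Set (Sym2 V) :=
  {e | ∃ x y, e = s(x, y) ∧ H.Adj x y ∧ f x = c ∧ f y = c'}

lemma cross_card {V : Type*} [Finite V] (H : SimpleGraph V) (f : V → V) (d : V → ℕ) (c c' : V)
    (hcc : c ≠ c')
    (hpar : ∀ x, f x ≠ x → ∃ y, H.Adj x y ∧ f y = f x ∧ d y < d x)
    (hamo : (∃ x y, H.Adj x y ∧ f x = c ∧ f y = c') →
      AtMostOneCycle (subG H {x | f x = c ∨ f x = c'})) :
    (crossE H f c c').ncard ≤ 2 := by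
  classical
  by_cases hex : ∃ x y, H.Adj x y ∧ f x = c ∧ f y = c'
  swap
  · have : crossE H f c c' = ∅ := by
      ext e
      simp only [crossE, Set.mem_ofPred_eq, Set.mem_empty_iff_false, iff_false]
      rintro ⟨x, y, -, h⟩
      exact hex ⟨x, y, h⟩
    simp [this]
  have h1 := unicyclic_card_on _ (hamo hex) {x | f x = c ∨ f x = c'} (fun x y h => h.2.1)
  set A : Set V := {x | f x = c ∨ f x = c'} with hA
  choose! p hp using hpar
  set T : Set (Sym2 V) := (fun x => s(x, p x)) '' (A \ {c, c'}) with hT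
  have hne : ∀ x ∈ A \ {c, c'}, f x ≠ x := by
    rintro x ⟨hx, hx'⟩ h
    simp only [hA, Set.mem_ofPred_eq, h] at hx
    exact hx' (by simpa using hx)
  have hTc : T.ncard = (A \ {c, c'}).ncard := by
    refine Set.InjOn.ncard_image ?_
    intro x hx y hy hxy
    have hx1 := hp x (hne x hx)
    have hy1 := hp y (hne y hy)
    simp only [Sym2.eq_iff] at hxy
    rcases hxy with h | ⟨h, h'⟩
    · exact h.1
    · rw [h'] at hx1
      rw [← h] at hy1
      omega
  have hTc2 : A.ncard ≤ T.ncard + 2 := by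
    rw [hTc]
    have := Set.le_ncard_sdiff ({c, c'} : Set V) A
    rw [Set.ncard_pair hcc] at this
    omega
  have hdisj : Disjoint T (crossE H f c c') := by
    rw [Set.disjoint_left]
    rintro e ⟨x, hx, rfl⟩ ⟨a, b, hab, -, ha, hb⟩
    have hx1 := hp x (hne x hx)
    simp only [Sym2.eq_iff] at hab
    rcases hab with ⟨rfl, h⟩ | ⟨rfl, h⟩
    · apply hcc
      rw [← ha, ← hb, ← h, hx1.2.1]
    · apply hcc
      rw [← ha, ← hb, ← h, hx1.2.1]
  have hsub : T ∪ crossE H f c c' ⊆ (subG H A).edgeSet := by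
    rintro e (⟨x, hx, rfl⟩ | ⟨a, b, rfl, hab, ha, hb⟩)
    · have hx1 := hp x (hne x hx)
      refine ⟨hx1.1, hx.1, ?_⟩
      have := hx.1
      simp only [hA, Set.mem_ofPred_eq] at this ⊢
      rw [hx1.2.1]; exact this
    · exact ⟨hab, Or.inl ha, Or.inr hb⟩
  have h2 := Set.ncard_le_ncard hsub (Set.toFinite _)
  rw [Set.ncard_union_eq hdisj (Set.toFinite _) (Set.toFinite _)] at h2
  omega

lemma cluster_bound {V : Type*} [Fintype V] (H : SimpleGraph V) (f : V → V) (d : V → ℕ)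
    (S : Finset V) (hfS : ∀ x, f x ∈ S)
    (hpar : ∀ x, f x ≠ x → ∃ y, H.Adj x y ∧ f y = f x ∧ d y < d x)
    (hone : ∀ c ∈ S, AtMostOneCycle (subG (cycG H) {x | f x = c}))
    (hamo : ∀ c ∈ S, ∀ c' ∈ S, (∃ x y, H.Adj x y ∧ f x = c ∧ f y = c') →
      AtMostOneCycle (subG H {x | f x = c ∨ f x = c'})) :
    {v | CycleMeetingPoint H v}.ncard ≤ 4 * (S.card * (S.card - 1)) := by
  classical
  have h0 := meeting_count H
  set W : Finset V := Finset.univ.filter (fun v => ∃ w, (cycG H).Adj v w) with hW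
  have hWc : {v | ∃ w, (cycG H).Adj v w}.ncard = W.card := by
    rw [← Set.ncard_coe_finset]; simp [hW]
  have hsum : W.card = ∑ c ∈ S, (W.filter (fun x => f x = c)).card :=
    Finset.card_eq_sum_card_fiberwise (fun x _ => hfS x)
  have hE : (cycG H).edgeSet.toFinset ⊆
      (S.biUnion fun c => (subG (cycG H) {x | f x = c}).edgeSet.toFinset) ∪
      (S.offDiag.biUnion fun q => (crossE H f q.1 q.2).toFinset) := by
    intro e
    induction e with | _ x y =>
    intro he
    have he : (cycG H).Adj x y := by simpa using he
    simp only [Finset.mem_union, Finset.mem_biUnion, Set.mem_toFinset]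
    by_cases hxy : f x = f y
    · left
      exact ⟨f x, hfS x, he, rfl, hxy.symm⟩
    · right
      exact ⟨(f x, f y), by simp [hfS, hxy], x, y, rfl, he.1, rfl, rfl⟩
  have hEc := Finset.card_le_card hE
  have h1 : (cycG H).edgeSet.ncard = (cycG H).edgeSet.toFinset.card := by
    rw [Set.ncard_eq_toFinset_card']
  have h2 : (S.biUnion fun c => (subG (cycG H) {x | f x = c}).edgeSet.toFinset).card ≤ W.card := by
    rw [hsum]
    refine Finset.card_biUnion_le.trans (Finset.sum_le_sum fun c hc => ?_)
    have := unicyclic_card_on _ (hone c hc) (W.filter (fun x => f x = c)) (by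
      intro x y h
      simp only [hW, Finset.coe_filter, Finset.mem_filter, Finset.mem_univ, true_and,
        Set.mem_ofPred_eq]
      exact ⟨⟨y, h.1⟩, h.2.1⟩)
    rw [Set.ncard_coe_finset, Set.ncard_eq_toFinset_card'] at this
    exact this
  have h3 : (S.offDiag.biUnion fun q => (crossE H f q.1 q.2).toFinset).card
      ≤ S.offDiag.card * 2 := by
    refine Finset.card_biUnion_le_card_mul _ _ _ fun q hq => ?_
    rw [Finset.mem_offDiag] at hq
    rw [← Set.ncard_eq_toFinset_card']
    exact cross_card H f d _ _ hq.2.2 hpar (hamo _ hq.1 _ hq.2.1)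
  have h4 := Finset.card_union_le
    (S.biUnion fun c => (subG (cycG H) {x | f x = c}).edgeSet.toFinset)
      (S.offDiag.biUnion fun q => (crossE H f q.1 q.2).toFinset)
  have h5 : S.offDiag.card = S.card * (S.card - 1) := by
    rw [Finset.offDiag_card, Nat.mul_sub, mul_one]
  rw [h5] at h3
  rw [hWc, h1] at h0
  omega

lemma exists_closer {V : Type*} {H : SimpleGraph V} (hH : H.Connected) (c x : V) (hx : c ≠ x) :
    ∃ y, H.Adj x y ∧ H.dist c y + 1 = H.dist c x := by
  obtain ⟨p, hp⟩ := hH.exists_walk_length_eq_dist x c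
  cases p with
  | nil => exact absurd rfl hx
  | cons h q =>
    rename_i y
    refine ⟨y, h, ?_⟩
    rw [SimpleGraph.Walk.length_cons] at hp
    have h1 : H.dist c y ≤ q.length := by rw [SimpleGraph.dist_comm]; exact SimpleGraph.dist_le q
    have h2 := hH.dist_triangle (u := c) (v := y) (w := x)
    have h3 : H.dist y x = 1 := SimpleGraph.dist_eq_one_iff_adj.2 h.symm
    rw [SimpleGraph.dist_comm] at hp
    omega

lemma exists_at_dist {V : Type*} {H : SimpleGraph V} (hH : H.Connected) (c : V) (n : ℕ) :
    ∀ x, H.dist c x = n → ∀ i ≤ n, ∃ y, H.dist c y = i := by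
  induction n with
  | zero => intro x hx i hi; exact ⟨x, by omega⟩
  | succ n ih =>
    intro x hx i hi
    rcases Nat.lt_or_ge n i with h | h
    · exact ⟨x, by omega⟩
    · have hne : c ≠ x := by rintro rfl; simp at hx
      obtain ⟨y, -, hy⟩ := exists_closer hH c x hne
      exact ih y (by omega) i h

lemma exists_packing {V : Type*} [Fintype V] (H : SimpleGraph V) (R : ℕ) :
    ∃ S : Finset V, (∀ c ∈ S, ∀ c' ∈ S, c ≠ c' → R < H.dist c c') ∧
      ∀ x, ∃ c ∈ S, H.dist c x ≤ R := by
  classical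
  obtain ⟨S, hS, hmax⟩ := Finset.exists_max_image
    ((Finset.univ : Finset (Finset V)).filter
      (fun S => ∀ c ∈ S, ∀ c' ∈ S, c ≠ c' → R < H.dist c c')) Finset.card ⟨∅, by simp⟩
  simp only [Finset.mem_filter, Finset.mem_univ, true_and] at hS hmax
  refine ⟨S, hS, fun x => ?_⟩
  by_contra hcon
  push Not at hcon
  have hx : x ∉ S := fun h => by simpa using hcon x h
  have := hmax (insert x S) (by
    intro c hc c' hc' hne
    rw [Finset.mem_insert] at hc hc'
    rcases hc with rfl | hc <;> rcases hc' with rfl | hc'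
    · exact absurd rfl hne
    · rw [SimpleGraph.dist_comm]; exact hcon _ hc'
    · exact hcon _ hc
    · exact hS _ hc _ hc' hne)
  rw [Finset.card_insert_of_notMem hx] at this
  omega

lemma packing_card {V : Type*} [Fintype V] {H : SimpleGraph V} (hH : H.Connected) (r : ℕ)
    (S : Finset V) (hS : ∀ c ∈ S, ∀ c' ∈ S, c ≠ c' → 2 * r < H.dist c c') (h2 : 2 ≤ S.card) :
    S.card * r ≤ H.edgeSet.ncard := by
  classical
  have hex : ∀ c ∈ S, ∀ i ≤ r, ∃ y, H.dist c y = i := by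
    intro c hc i hi
    obtain ⟨c', hc', hne⟩ := Finset.exists_mem_ne (by omega : 1 < S.card) c
    have := hS c hc c' hc' hne.symm
    exact exists_at_dist hH c _ c' rfl i (by omega)
  choose! g hg using hex
  have hcard : (S ×ˢ Finset.range (r + 1)).card ≤ (Finset.univ : Finset V).card := by
    refine Finset.card_le_card_of_injOn (fun q => g q.1 q.2) (fun _ _ => by simp) ?_
    rintro ⟨c, i⟩ hq ⟨c', i'⟩ hq' heq
    simp only [Finset.coe_product, Set.mem_prod, Finset.mem_coe, Finset.mem_range] at hq hq' heq
    have h1 := hg c hq.1 i (by omega)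
    have h1' := hg c' hq'.1 i' (by omega)
    rw [← heq] at h1'
    have hcc : c = c' := by
      by_contra hne
      have h3 := hS c hq.1 c' hq'.1 hne
      have h4 := hH.dist_triangle (u := c) (v := g c i) (w := c')
      rw [SimpleGraph.dist_comm (u := g c i)] at h4
      omega
    subst hcc
    rw [h1] at h1'
    rw [h1']
  rw [Finset.card_product, Finset.card_range, Finset.card_univ] at hcard
  have h5 := hH.card_vert_le_card_edgeSet_add_one
  rw [Nat.card_eq_fintype_card, Nat.card_coe_set_eq] at h5
  nlinarith

lemma exists_voronoi {V : Type*} [Fintype V] {H : SimpleGraph V} (hH : H.Connected) (S : Finset V)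
    (hS : S.Nonempty) :
    ∃ f : V → V, (∀ x, f x ∈ S) ∧ (∀ x, ∀ c ∈ S, H.dist (f x) x ≤ H.dist c x) ∧
      ∀ x, f x ≠ x → ∃ y, H.Adj x y ∧ f y = f x ∧ H.dist (f y) y < H.dist (f x) x := by
  classical
  set N := Fintype.card V with hN
  let idx : V → ℕ := fun c => (Fintype.equivFin V c : ℕ)
  have hidx : ∀ c, idx c < N := fun c => (Fintype.equivFin V c).2
  have hinj : ∀ c c', idx c = idx c' → c = c' := fun c c' h =>
    (Fintype.equivFin V).injective (Fin.ext h)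
  have hmin : ∀ x, ∃ c ∈ S, ∀ c' ∈ S, H.dist c x * N + idx c ≤ H.dist c' x * N + idx c' :=
    fun x => Finset.exists_min_image S (fun c => H.dist c x * N + idx c) hS
  choose f hfS hf using hmin
  have hd : ∀ x, ∀ c ∈ S, H.dist (f x) x ≤ H.dist c x := by
    intro x c hc
    by_contra hlt
    have h1 := hf x c hc
    have h2 := hidx c
    have h3 : H.dist c x + 1 ≤ H.dist (f x) x := by omega
    nlinarith
  refine ⟨f, hfS, hd, fun x hx => ?_⟩
  obtain ⟨y, hxy, hy⟩ := exists_closer hH (f x) x hx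
  have hyx : H.dist y x = 1 := SimpleGraph.dist_eq_one_iff_adj.2 hxy.symm
  have h1 := hf y (f x) (hfS x)
  have h2 := hf x (f y) (hfS y)
  have h3 := hH.dist_triangle (u := f y) (v := y) (w := x)
  have h4 := hd y (f x) (hfS x)
  have h5 := hd x (f y) (hfS y)
  have e1 : H.dist (f y) y = H.dist (f x) y := by omega
  have e2 : H.dist (f y) x = H.dist (f x) x := by omega
  rw [e1] at h1
  rw [e2] at h2
  have e3 : f y = f x := hinj _ _ (by omega)
  exact ⟨y, hxy, e3, by rw [e3]; omega⟩

lemma connected_bound {V : Type*} [Fintype V] {H : SimpleGraph V} (hH : H.Connected) (r ℓ : ℕ)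
    (hr : 6 * r + 1 ≤ ℓ) (hT : H.TangleFree ℓ) :
    ∃ m, {v | CycleMeetingPoint H v}.ncard ≤ 4 * (m * (m - 1)) ∧
      (2 ≤ m → m * r ≤ H.edgeSet.ncard) := by
  classical
  obtain ⟨S, hS, hcov⟩ := exists_packing H (2 * r)
  have hne : S.Nonempty := by
    obtain ⟨x⟩ := hH.nonempty
    obtain ⟨c, hc, -⟩ := hcov x
    exact ⟨c, hc⟩
  obtain ⟨f, hfS, hd, hpar⟩ := exists_voronoi hH S hne
  have hd2 : ∀ x, H.dist (f x) x ≤ 2 * r := fun x => by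
    obtain ⟨c, hc, h⟩ := hcov x
    exact (hd x c hc).trans h
  refine ⟨S.card, ?_, packing_card hH r S hS⟩
  refine cluster_bound H f (fun x => H.dist (f x) x) S hfS hpar ?_ ?_
  · intro c hc
    refine tangle_amo (fun x y h => h.1.1) hT c ?_
    rintro x y ⟨-, h, -⟩
    have h : f x = c := h
    have := hd2 x
    rw [h] at this
    omega
  · rintro c hc c' hc' ⟨a, b, hab, ha, hb⟩
    refine tangle_amo (fun x y h => h.1) hT c ?_
    rintro x y ⟨-, h, -⟩
    have hx := hd2 x
    rcases h with h | h
    · rw [h] at hx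
      omega
    · rw [h] at hx
      have h1 := hd2 a
      have h2 := hd2 b
      rw [ha] at h1
      rw [hb] at h2
      have h3 : H.dist a b = 1 := SimpleGraph.dist_eq_one_iff_adj.2 hab
      have t1 := hH.dist_triangle (u := c) (v := a) (w := b)
      have t2 := hH.dist_triangle (u := c) (v := b) (w := c')
      have t3 := hH.dist_triangle (u := c) (v := c') (w := x)
      rw [SimpleGraph.dist_comm (u := b)] at t2
      omega

lemma amo_bound {V : Type*} [Fintype V] {H : SimpleGraph V} (h : AtMostOneCycle (cycG H)) :
    {v | CycleMeetingPoint H v}.ncard = 0 := by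
  have h0 := meeting_count H
  have h1 := unicyclic_card_on _ h {v | ∃ w, (cycG H).Adj v w} (fun x y h => ⟨y, h⟩)
  omega

lemma pathGraph_reach {V : Type*} (P : ℕ → V) (m t : ℕ) (ht : t ≤ m) :
    (pathGraph P m).Reachable (P 0) (P t) := by
  induction t with
  | zero => exact SimpleGraph.Reachable.refl _
  | succ t ih =>
    refine (ih (by omega)).trans ?_
    by_cases h : P t = P (t + 1)
    · rw [h]
    · refine SimpleGraph.Adj.reachable ?_
      rw [pathGraph, SimpleGraph.fromEdgeSet_adj]
      exact ⟨⟨t, by omega, rfl⟩, h⟩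

lemma pathGraph_adj {V : Type*} (P : ℕ → V) (m : ℕ) (x y : V) (h : (pathGraph P m).Adj x y) :
    (pathGraph P m).Reachable (P 0) x := by
  rw [pathGraph, SimpleGraph.fromEdgeSet_adj] at h
  obtain ⟨⟨t, ht, he⟩, -⟩ := h
  rw [Sym2.eq_iff] at he
  rcases he with ⟨rfl, -⟩ | ⟨rfl, -⟩
  · exact pathGraph_reach P m t (by omega)
  · exact pathGraph_reach P m (t + 1) (by omega)

/-- There is a universal constant `C > 0` such that for any closed path `P`
of length `2k` on a graph `G`, if the traversed subgraph `G_P` is `ℓ`-tangle free with `ℓ ≥ 2`,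
then the number of cycle meeting points of `G_P` is at most `C |E_P|² / ℓ²`. -/
theorem stmt_3 : ∃ C : ℝ, 0 < C ∧
    ∀ (V : Type) [Fintype V] [DecidableEq V] (G : SimpleGraph V) (k ℓ : ℕ) (P : ℕ → V),
      2 ≤ ℓ →
      (∀ t < 2 * k, G.Adj (P t) (P (t + 1))) →
      P 0 = P (2 * k) →
      (pathGraph P (2 * k)).TangleFree ℓ →
      (({v | CycleMeetingPoint (pathGraph P (2 * k)) v}).ncard : ℝ)
        ≤ C * ((pathGraph P (2 * k)).edgeSet.ncard : ℝ) ^ 2 / (ℓ : ℝ) ^ 2 := by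
  refine ⟨1024, by norm_num, ?_⟩
  intro V _ _ G k ℓ P hℓ _ _ hT
  set H := pathGraph P (2 * k) with hH
  have hℓ0 : (0 : ℝ) < (ℓ : ℝ) ^ 2 := by positivity
  rw [le_div_iff₀ hℓ0]
  by_cases hconn : H.Connected
  swap
  · -- some vertex is unreachable, so all cycles coincide
    obtain ⟨w, hw⟩ : ∃ w, ¬ H.Reachable (P 0) w := by
      by_contra hcon
      push Not at hcon
      haveI : Nonempty V := ⟨P 0⟩
      exact hconn ⟨fun x y => (hcon x).symm.trans (hcon y)⟩
    have h0 := amo_bound (H := H) (tangle_amo (cycG_le H) hT w (by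
      intro x y hxy
      have h1 := pathGraph_adj P (2 * k) x y hxy.1
      rw [SimpleGraph.dist_eq_zero_of_not_reachable]
      · omega
      · exact fun h2 => hw (h1.trans h2.symm)))
    rw [h0]
    simp only [Nat.cast_zero, zero_mul]
    positivity
  by_cases h8 : ℓ < 8
  · have h1 := meeting_count H
    have h2 : (cycG H).edgeSet.ncard ≤ H.edgeSet.ncard :=
      Set.ncard_le_ncard (SimpleGraph.edgeSet_mono (cycG_le H)) (Set.toFinite _)
    have h3 : {v | CycleMeetingPoint H v}.ncard ≤ 2 * H.edgeSet.ncard ^ 2 := by nlinarith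
    have h4 : {v | CycleMeetingPoint H v}.ncard * ℓ ^ 2 ≤ 1024 * H.edgeSet.ncard ^ 2 := by
      calc _ ≤ (2 * H.edgeSet.ncard ^ 2) * 8 ^ 2 :=
            Nat.mul_le_mul h3 (Nat.pow_le_pow_left h8.le 2)
        _ ≤ _ := by omega
    exact_mod_cast h4
  · obtain ⟨m, hm, hm2⟩ := connected_bound hconn (ℓ / 8) ℓ (by omega) hT
    have h4 : {v | CycleMeetingPoint H v}.ncard * ℓ ^ 2 ≤ 1024 * H.edgeSet.ncard ^ 2 := by
      by_cases h2 : 2 ≤ m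
      · have h5 := hm2 h2
        have h6 : ℓ ≤ 16 * (ℓ / 8) := by omega
        have h7 : m * ℓ ≤ 16 * H.edgeSet.ncard := by
          calc m * ℓ ≤ m * (16 * (ℓ / 8)) := Nat.mul_le_mul_left _ h6
            _ = 16 * (m * (ℓ / 8)) := by ring
            _ ≤ _ := Nat.mul_le_mul_left _ h5
        calc _ ≤ (4 * (m * m)) * ℓ ^ 2 := by
              refine Nat.mul_le_mul_right _ (hm.trans ?_)
              exact Nat.mul_le_mul_left _ (Nat.mul_le_mul_left _ (Nat.sub_le _ _))
          _ = 4 * (m * ℓ) ^ 2 := by ring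
          _ ≤ 4 * (16 * H.edgeSet.ncard) ^ 2 :=
            Nat.mul_le_mul_left _ (Nat.pow_le_pow_left h7 2)
          _ = _ := by ring
      · have : m * (m - 1) = 0 := by
          have : m - 1 = 0 := by omega
          rw [this, mul_zero]
        rw [this] at hm
        have : {v | CycleMeetingPoint H v}.ncard = 0 := by omega
        rw [this]
        simp
    exact_mod_cast h4
end

section
/- Let k ∈ ℕ, let G be a graph, and let P be a closed path of length 2k on G. Suppose t < t' are times in [0,2k] such that: (1) no time in [t+1, t'] belongs to A ∪ C (the sets of special-cycle-vertex times and irregular cycle-edge times of the data structure of P); (2) H(t) = H(t') where H is the diagram of P; and (3) H(τ) ≥ H(t) for all τ ∈ [t, t']. Then P(t) = P(t'). -/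
/-- The edge `i↔j` is uncovered in direction `i → j` by the first `m` steps of `P`. -/
def UncovTo {V : Type*} (P : ℕ → V) (m : ℕ) (i j : V) : Prop :=
  ∃ t < m, P t = i ∧ P (t + 1) = j ∧ ∀ t' < t, s(P t', P (t' + 1)) ≠ s(i, j)

/-- A vertex `v` is a *splitting point* of the subgraph traversed by the first `m` steps. -/
def SplittingPoint {V : Type*} (P : ℕ → V) (m : ℕ) (v : V) : Prop :=
  ∃ i j : V, i ≠ j ∧
    (pathGraph P m).IsCycleEdge s(v, i) ∧ (pathGraph P m).IsCycleEdge s(v, j) ∧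
    UncovTo P m v i ∧ UncovTo P m v j

/-- The set of (edge sets of) cycles of a graph. -/
def cycleSets {V : Type*} (H : SimpleGraph V) : Set (Set (Sym2 V)) :=
  {E | ∃ (v : V) (c : H.Walk v v), c.IsCycle ∧ E = {e | e ∈ c.edges}}

/-- A vertex `v` is a *cycle completion point*: at some time `t` with `P t = v`, the set
of cycles of the traversed subgraph strictly increases. -/
def CycleCompletionPoint {V : Type*} (P : ℕ → V) (m : ℕ) (v : V) : Prop :=
  ∃ t, 1 ≤ t ∧ t ≤ m ∧ P t = v ∧ cycleSets (pathGraph P (t - 1)) ⊂ cycleSets (pathGraph P t)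

/-- `v` is a *special cycle vertex* of the subgraph traversed by the first `m` steps of `P`. -/
def SpecialBy {V : Type*} (P : ℕ → V) (m : ℕ) (v : V) : Prop :=
  CycleMeetingPoint (pathGraph P m) v ∨ SplittingPoint P m v ∨ CycleCompletionPoint P m v

/-- The discovery time of `v` as a special cycle vertex is at most `s`. -/
def DiscoveredBy {V : Type*} (P : ℕ → V) (s : ℕ) (v : V) : Prop :=
  ∃ m ≤ s, SpecialBy P m v

/-- The edge travelled at step `t` of `P` was travelled at some earlier step. -/
def TraveledBefore {V : Type*} (P : ℕ → V) (t : ℕ) : Prop :=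
  ∃ t' < t, s(P t', P (t' + 1)) = s(P t, P (t + 1))

/-- The first traversal of the edge travelled at step `t` was in the same direction. -/
def FirstDirSame {V : Type*} (P : ℕ → V) (t : ℕ) : Prop :=
  ∀ t₀ < t, s(P t₀, P (t₀ + 1)) = s(P t, P (t + 1)) →
    (∀ t' < t₀, s(P t', P (t' + 1)) ≠ s(P t, P (t + 1))) → P t₀ = P t

/-- The first traversal of the edge travelled at step `t` was in the opposite direction. -/
def FirstDirOpp {V : Type*} (P : ℕ → V) (t : ℕ) : Prop :=
  ∀ t₀ < t, s(P t₀, P (t₀ + 1)) = s(P t, P (t + 1)) →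
    (∀ t' < t₀, s(P t', P (t' + 1)) ≠ s(P t, P (t + 1))) → P t₀ = P (t + 1)

/-- Multiplicity of the edge `e` in the closed path `P` of length `2k`. -/
noncomputable def edgeMult {V : Type*} (P : ℕ → V) (k : ℕ) (e : Sym2 V) : ℕ :=
  ({t | t < 2 * k ∧ s(P t, P (t + 1)) = e}).ncard

/-- The set `C_P` (in paper time `τ ∈ [1,2k]`): times whose step traverses a cycle edge of
`G_P` of multiplicity one or at least three. -/
def CSet {V : Type*} (P : ℕ → V) (k : ℕ) : Set ℕ :=
  {τ | 1 ≤ τ ∧ τ ≤ 2 * k ∧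
    (pathGraph P (2 * k)).IsCycleEdge s(P (τ - 1), P τ) ∧
    (edgeMult P k s(P (τ - 1), P τ) = 1 ∨ 3 ≤ edgeMult P k s(P (τ - 1), P τ))}

/-- The set `A_P` (in paper time `τ ∈ [1,2k]`), defined through the diagram `H`: `τ ∈ A_P`
iff either `P(τ−1)` is a special cycle vertex discovered by time `τ−1` and the arrow from
`τ−1` to `τ` is a down arrow, or `P τ` is such a vertex and the arrow is an up arrow. -/
def ASet {V : Type*} (P : ℕ → V) (k : ℕ) (H : ℕ → ℤ) : Set ℕ :=
  {τ | 1 ≤ τ ∧ τ ≤ 2 * k ∧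
    ((DiscoveredBy P (τ - 1) (P (τ - 1)) ∧ H τ = H (τ - 1) - 1) ∨
      (DiscoveredBy P (τ - 1) (P τ) ∧ H τ = H (τ - 1) + 1))}

namespace Stmt16

variable {V : Type*}

/-- The edge of step `i`. -/
def E (P : ℕ → V) (i : ℕ) : Sym2 V := s(P i, P (i + 1))

/-- Step `i` is the first traversal of its edge. -/
def First (P : ℕ → V) (i : ℕ) : Prop := ∀ j < i, E P j ≠ E P i

lemma exists_first (P : ℕ → V) (i : ℕ) : ∃ p ≤ i, E P p = E P i ∧ First P p := by
  classical
  have h : ∃ p, E P p = E P i := ⟨i, rfl⟩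
  refine ⟨Nat.find h, Nat.find_min' h rfl, Nat.find_spec h, ?_⟩
  intro j hj h2
  exact Nat.find_min h hj (h2.trans (Nat.find_spec h))

lemma reach (P : ℕ → V) (m : ℕ) (e : Sym2 V) (a b : ℕ) (hab : a ≤ b) (hb : b ≤ m)
    (h : ∀ i, a ≤ i → i < b → E P i ≠ e) :
    (pathGraph P m \ SimpleGraph.fromEdgeSet {e}).Reachable (P a) (P b) := by
  induction b, hab using Nat.le_induction with
  | base => exact SimpleGraph.Reachable.refl _
  | succ n hn ih =>
    refine (ih (by omega) (fun i h1 h2 => h i h1 (by omega))).trans ?_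
    by_cases hne : P n = P (n + 1)
    · rw [hne]
    · apply SimpleGraph.Adj.reachable
      have := h n hn (by omega)
      simp only [SimpleGraph.sdiff_adj, pathGraph, SimpleGraph.fromEdgeSet_adj]
      refine ⟨⟨⟨n, by omega, rfl⟩, hne⟩, ?_⟩
      rintro ⟨h1, -⟩
      exact this h1

lemma adj_path (P : ℕ → V) (m i : ℕ) (hi : i < m) (hne : P i ≠ P (i + 1)) :
    (pathGraph P m).Adj (P i) (P (i + 1)) := by
  simp only [pathGraph, SimpleGraph.fromEdgeSet_adj]
  exact ⟨⟨i, hi, rfl⟩, hne⟩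

lemma cyc_of_reach (H : SimpleGraph V) (u v : V) (h : H.Adj u v)
    (hr : (H \ SimpleGraph.fromEdgeSet {s(u, v)}).Reachable u v) :
    H.IsCycleEdge s(u, v) :=
  SimpleGraph.adj_and_reachable_delete_edges_iff_exists_cycle.1 ⟨h, hr⟩

lemma path_mono (P : ℕ → V) {m n : ℕ} (h : m ≤ n) : pathGraph P m ≤ pathGraph P n := by
  apply SimpleGraph.fromEdgeSet_mono
  rintro e ⟨t, ht, rfl⟩
  exact ⟨t, by omega, rfl⟩

lemma cyc_mono {H K : SimpleGraph V} (h : H ≤ K) {e : Sym2 V} (he : H.IsCycleEdge e) :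
    K.IsCycleEdge e := by
  obtain ⟨v, c, hc, hm⟩ := he
  exact ⟨v, c.mapLe h, hc.mapLe h, by simpa using hm⟩

lemma cycleSets_mono {H K : SimpleGraph V} (h : H ≤ K) : cycleSets H ⊆ cycleSets K := by
  rintro F ⟨v, c, hc, rfl⟩
  exact ⟨v, c.mapLe h, hc.mapLe h, by simp⟩

/-- A segment of the path joining the ends of an edge and avoiding it closes a cycle. -/
lemma cyc_of_seg (P : ℕ → V) (m i a b : ℕ) (hi : i < m) (hne : P i ≠ P (i + 1))
    (hab : a ≤ b) (hb : b ≤ m) (h : ∀ j, a ≤ j → j < b → E P j ≠ E P i)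
    (hend : s(P a, P b) = E P i) : (pathGraph P m).IsCycleEdge (E P i) := by
  have hr := reach P m (E P i) a b hab hb h
  have hadj := adj_path P m i hi hne
  unfold E at *
  rcases Sym2.eq_iff.1 hend with ⟨h1, h2⟩ | ⟨h1, h2⟩
  · rw [h1, h2] at hr
    exact cyc_of_reach _ _ _ hadj hr
  · rw [h1, h2] at hr
    exact cyc_of_reach _ _ _ hadj hr.symm

lemma bridge_first (P : ℕ → V) (m i : ℕ) (hi : i < m) (hne : P i ≠ P (i + 1))
    (hbr : ¬ (pathGraph P m).IsCycleEdge (E P i)) (hf : First P i) (j : ℕ) (hj : j ≤ i) :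
    P j ≠ P (i + 1) := by
  intro h
  apply hbr
  refine cyc_of_seg P m i j i hi hne hj hi.le (fun l _ h2 => hf l h2) ?_
  rw [h, E, Sym2.eq_swap]

lemma completion (P : ℕ → V) (i j : ℕ) (hne : P i ≠ P (i + 1)) (hf : First P i)
    (hj : j ≤ i) (h : P j = P (i + 1)) (s : ℕ) (hs : i + 1 ≤ s) :
    DiscoveredBy P s (P (i + 1)) := by
  refine ⟨i + 1, hs, Or.inr (Or.inr ⟨i + 1, by omega, le_rfl, rfl, ?_⟩)⟩
  rw [Nat.add_sub_cancel]
  refine ⟨cycleSets_mono (path_mono P (by omega)), fun hsub => ?_⟩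
  have hc : (pathGraph P (i + 1)).IsCycleEdge (E P i) := by
    refine cyc_of_seg P (i + 1) i j i (by omega) hne hj (by omega) (fun l _ h2 => hf l h2) ?_
    rw [h, E, Sym2.eq_swap]
  obtain ⟨v, c, hc, hm⟩ := hc
  obtain ⟨v', c', hc', he⟩ := hsub ⟨v, c, hc, rfl⟩
  have hm' : E P i ∈ {e | e ∈ c.edges} := hm
  rw [he] at hm'
  have := c'.edges_subset_edgeSet hm'
  simp only [pathGraph, SimpleGraph.edgeSet_fromEdgeSet] at this
  obtain ⟨⟨l, hl, hle⟩, -⟩ := this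
  exact hf l hl hle.symm

lemma mult3 (P : ℕ → V) (k i j l : ℕ) (hij : i < j) (hjl : j < l) (hl : l < 2 * k)
    (h1 : E P i = E P l) (h2 : E P j = E P l) : 3 ≤ edgeMult P k (E P l) := by
  have hsub : ((({i, j, l} : Finset ℕ) : Set ℕ)) ⊆ {t | t < 2 * k ∧ s(P t, P (t + 1)) = E P l} := by
    intro x hx
    simp only [Finset.coe_insert, Finset.coe_singleton, Set.mem_insert_iff,
      Set.mem_singleton_iff] at hx
    rcases hx with rfl | rfl | rfl
    · exact ⟨by omega, h1⟩
    · exact ⟨by omega, h2⟩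
    · exact ⟨by omega, rfl⟩
  have hfin : ({t | t < 2 * k ∧ s(P t, P (t + 1)) = E P l} : Set ℕ).Finite :=
    (Set.finite_lt_nat (2 * k)).subset (fun x hx => hx.1)
  have := Set.ncard_le_ncard hsub hfin
  rw [Set.ncard_coe_finset, Finset.card_eq_three.2 ⟨i, j, l, by omega, by omega, by omega, rfl⟩]
    at this
  exact this

/-- The case of a down step along a cycle edge, first travelled before the up step along an old
bridge. -/
lemma core_old (P : ℕ → V) (m : ℕ) (hne : ∀ i < m, P i ≠ P (i + 1))
    (a c r s : ℕ) (hac : a < c) (hc : c < m) (hv : P (a + 1) = P c) (hra : r < a)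
    (hr : First P r) (hru : P r = P a) (hrv : P (r + 1) = P (a + 1))
    (hbr : ¬ (pathGraph P m).IsCycleEdge (E P r))
    (hdisc : ¬ DiscoveredBy P c (P c)) (hsa : s < a) (hs : First P s) (hsE : E P s = E P c)
    (hthree : ∀ i j, i < j → j < c → E P i = E P c → E P j = E P c → False)
    (huw : P a ≠ P (c + 1)) : False := by
  have hb := bridge_first P m r (by omega) (hne r (by omega)) hbr hr
  have hvw := hne c hc
  have hsne := hne s (by omega)
  rcases Sym2.eq_iff.1 hsE with ⟨h1, h2⟩ | ⟨h1, h2⟩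
  · -- `v → w` first
    have hrs : r < s := by
      by_contra hcon
      exact hb s (by omega) (by rw [h1, hrv, hv])
    -- return time
    have hret : ∃ q, s < q ∧ q ≤ a ∧ P q = P c := by
      by_contra hcon
      push Not at hcon
      apply hbr
      refine cyc_of_seg P m r s a (by omega) (hne r (by omega)) hsa.le (by omega) ?_ ?_
      · intro j hj1 hj2 hj3
        rcases Sym2.eq_iff.1 hj3 with ⟨h3, h4⟩ | ⟨h3, h4⟩
        · exact hcon (j + 1) (by omega) (by omega) (by rw [h4, hrv, hv])
        · rcases Nat.eq_or_lt_of_le hj1 with rfl | hlt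
          · apply huw; rw [← hru, ← h4, h2]
          · exact hcon j hlt hj2.le (by rw [h3, hrv, hv])
      · rw [E, h1, hru, hrv, hv, Sym2.eq_swap]
    classical
    obtain ⟨hq1, hq2, hq3⟩ := Nat.find_spec hret
    have hqmin := fun j (hj : j < Nat.find hret) => Nat.find_min hret hj
    generalize Nat.find hret = q at hq1 hq2 hq3 hqmin
    obtain ⟨q, rfl⟩ : ∃ q', q = q' + 1 := ⟨q - 1, by omega⟩
    have hsq : s < q := by
      rcases Nat.lt_or_ge s q with h | h
      · exact h
      · have : s = q := by omega
        subst this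
        exact absurd (hq3.symm.trans h2) hvw
    have hav : ∀ j, s < j → j ≤ q → P j ≠ P c := fun j hj1 hj2 hj3 =>
      hqmin j (by omega) ⟨hj1, by omega, hj3⟩
    have hxw : P q ≠ P (c + 1) := by
      intro hx
      refine hthree s q hsq (by omega) hsE ?_
      rw [E, E, hx, hq3, Sym2.eq_swap]
    have hqne := hne q (by omega)
    have hcx : (pathGraph P a).IsCycleEdge (E P q) := by
      refine cyc_of_seg P a q s q (by omega) hqne hsq.le (by omega) ?_ ?_
      · intro j hj1 hj2 hj3
        rcases Nat.eq_or_lt_of_le hj1 with rfl | hlt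
        · rcases Sym2.eq_iff.1 hj3 with ⟨h3, h4⟩ | ⟨h3, h4⟩
          · exact hqne (by rw [hq3, ← h3, h1])
          · exact hxw (by rw [← h4, h2])
        · rcases Sym2.eq_iff.1 hj3 with ⟨h3, h4⟩ | ⟨h3, h4⟩
          · exact hav (j + 1) (by omega) (by omega) (by rw [h4, hq3])
          · exact hav j hlt hj2.le (by rw [h3, hq3])
      · rw [E, h1, hq3, Sym2.eq_swap]
    have hcw : (pathGraph P a).IsCycleEdge (E P s) := by
      refine cyc_of_seg P a s (s + 1) (q + 1) (by omega) hsne (by omega) (by omega) ?_ ?_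
      · intro j hj1 hj2 hj3
        exact hthree s j (by omega) (by omega) hsE (hj3.trans hsE)
      · rw [E, h1, hq3, Sym2.eq_swap]
    obtain ⟨p, hp1, hp2, hp3⟩ := exists_first P q
    rcases Sym2.eq_iff.1 hp2 with ⟨h3, h4⟩ | ⟨h3, h4⟩
    · have hrp : r ≤ p := by
        by_contra hcon
        exact hb (p + 1) (by omega) (by rw [h4, hq3, hrv, hv])
      have hrp' : r ≠ p := by
        rintro rfl
        apply hbr
        rw [hp2]
        exact cyc_mono (path_mono P (by omega)) hcx
      apply hdisc
      have := completion P p (r + 1) (hne p (by omega)) hp3 (by omega)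
        (by rw [h4, hq3, hrv, hv]) c (by omega)
      rwa [h4, hq3] at this
    · apply hdisc
      refine ⟨a, hac.le, Or.inr (Or.inl ⟨P (c + 1), P q, hxw.symm, ?_, ?_, ?_, ?_⟩)⟩
      · rwa [E, h1, h2] at hcw
      · rwa [E, hq3, Sym2.eq_swap] at hcx
      · refine ⟨s, hsa, h1, h2, fun j hj => ?_⟩
        have := hs j hj
        rwa [hsE] at this
      · refine ⟨p, by omega, by rw [h3, hq3], h4, fun j hj => ?_⟩
        have := hp3 j hj
        rw [E, E, h3, h4, hq3] at this
        exact this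
  · -- `w → v` first
    have hrs : r < s := by
      by_contra hcon
      rcases Nat.eq_or_lt_of_le (not_lt.1 hcon) with rfl | hlt
      · exact huw (by rw [← hru, h1])
      · exact hb (s + 1) (by omega) (by rw [h2, hrv, hv])
    apply hdisc
    have := completion P s (r + 1) hsne hs (by omega) (by rw [h2, hrv, hv]) c (by omega)
    rwa [h2] at this

lemma core (P : ℕ → V) (m : ℕ) (hne : ∀ i < m, P i ≠ P (i + 1))
    (a c : ℕ) (hac : a < c) (hc : c < m) (hv : P (a + 1) = P c)
    (hup : First P a ∨ ∃ r < a, First P r ∧ P r = P a ∧ P (r + 1) = P (a + 1) ∧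
      ¬ (pathGraph P m).IsCycleEdge (E P r))
    (hdisc : ¬ DiscoveredBy P c (P c))
    (s : ℕ) (hsc : s < c) (hs : First P s) (hsE : E P s = E P c)
    (hdown : (P s = P (c + 1) ∧ P (s + 1) = P c ∧ ¬ (pathGraph P m).IsCycleEdge (E P s)) ∨
      (s ≤ a ∧ ∀ i j, i < j → j < c → E P i = E P c → E P j = E P c → False)) :
    P a = P (c + 1) := by
  by_contra huw
  have hvw := hne c hc
  have hane := hne a (by omega)
  have hsa : s ≠ a := by
    rintro rfl
    rcases Sym2.eq_iff.1 hsE with ⟨h1, h2⟩ | ⟨h1, h2⟩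
    · exact hane (by rw [hv, h1])
    · exact huw h1
  -- a new edge to an old vertex is impossible
  have hK : First P a → ∀ j ≤ a, P j ≠ P c := by
    intro hf j hj h
    apply hdisc
    have := completion P a j hane hf hj (by rw [h, hv]) c (by omega)
    rwa [hv] at this
  rcases hdown with ⟨h1, h2, hbr⟩ | ⟨hle, hthree⟩
  · have hb := bridge_first P m s (by omega) (hne s (by omega)) hbr hs
    rcases hup with hf | ⟨r, hra, hr, hru, hrv, hbr'⟩
    · rcases Nat.lt_or_gt_of_ne hsa with h | h
      · exact hK hf (s + 1) (by omega) h2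
      · exact hb (a + 1) (by omega) (by rw [hv, h2])
    · have hb' := bridge_first P m r (by omega) (hne r (by omega)) hbr' hr
      rcases lt_trichotomy r s with h | h | h
      · exact hb (r + 1) (by omega) (by rw [hrv, hv, h2])
      · subst h
        exact huw (by rw [← hru, h1])
      · exact hb' (s + 1) (by omega) (by rw [hrv, hv, h2])
  · have hlt : s < a := by omega
    rcases hup with hf | ⟨r, hra, hr, hru, hrv, hbr'⟩
    · rcases Sym2.eq_iff.1 hsE with ⟨h1, h2⟩ | ⟨h1, h2⟩
      · exact hK hf s hle h1
      · exact hK hf (s + 1) (by omega) h2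
    · exact core_old P m hne a c r s hac hc hv hra hr hru hrv hbr' hdisc hlt hs hsE hthree huw

/-- First return below the starting level. -/
lemma first_return (H : ℕ → ℤ) (m : ℕ) (hpm : ∀ i < m, H (i + 1) = H i + 1 ∨ H (i + 1) = H i - 1)
    (a b : ℕ) (hab : a < b) (hb : b ≤ m) (hup : H (a + 1) = H a + 1) (hle : H b ≤ H a) :
    ∃ c, a < c ∧ c < b ∧ H (c + 1) = H a ∧ H c = H a + 1 ∧ ∀ i, a < i → i ≤ c → H a + 1 ≤ H i := by
  classical
  have hex : ∃ x, a < x ∧ H x ≤ H a := ⟨b, hab, hle⟩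
  obtain ⟨h1, h2⟩ := Nat.find_spec hex
  have h3 := fun j (hj : j < Nat.find hex) => Nat.find_min hex hj
  have h4 := Nat.find_min' hex ⟨hab, hle⟩
  generalize Nat.find hex = x at h1 h2 h3 h4
  obtain ⟨c, rfl⟩ : ∃ c, x = c + 1 := ⟨x - 1, by omega⟩
  have hac : a < c := by
    rcases Nat.lt_or_ge a c with h | h
    · exact h
    · have : a = c := by omega
      subst this
      omega
  have h5 : ∀ i, a < i → i ≤ c → H a + 1 ≤ H i := by
    intro i hi hic
    by_contra hcon
    exact h3 i (by omega) ⟨hi, by omega⟩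
  have := h5 c hac le_rfl
  have := hpm c (by omega)
  exact ⟨c, hac, by omega, by omega, by omega, h5⟩

end Stmt16

/-- Let `P` be a closed path of length `2k` on `G` with diagram `H`.
If `t < t'` are times such that `[t+1, t']` avoids `A_P ∪ C_P`, `H t = H t'`, and
`H τ ≥ H t` for all `τ ∈ [t, t']`, then `P t = P t'`. -/
theorem stmt_16 {V : Type*} [Fintype V] [DecidableEq V] (G : SimpleGraph V)
    (k : ℕ) (P : ℕ → V)
    (hadj : ∀ t < 2 * k, G.Adj (P t) (P (t + 1)))
    (hclosed : P 0 = P (2 * k))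
    (H : ℕ → ℤ) (hH0 : H 0 = 0)
    (hnew : ∀ t < 2 * k, ¬ TraveledBefore P t → H (t + 1) = H t + 1)
    (hfwd : ∀ t < 2 * k,
      ¬ (pathGraph P (2 * k)).IsCycleEdge s(P t, P (t + 1)) →
      TraveledBefore P t → FirstDirSame P t → H (t + 1) = H t + 1)
    (hbwd : ∀ t < 2 * k,
      ¬ (pathGraph P (2 * k)).IsCycleEdge s(P t, P (t + 1)) →
      TraveledBefore P t → FirstDirOpp P t → H (t + 1) = H t - 1)
    (hcyc : ∀ t < 2 * k,
      (pathGraph P (2 * k)).IsCycleEdge s(P t, P (t + 1)) →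
      TraveledBefore P t → H (t + 1) = H t - 1)
    (t t' : ℕ) (htt' : t < t') (ht' : t' ≤ 2 * k)
    (havoid : ∀ τ, t + 1 ≤ τ → τ ≤ t' → τ ∉ ASet P k H ∪ CSet P k)
    (heq : H t = H t')
    (hmin : ∀ τ, t ≤ τ → τ ≤ t' → H t ≤ H τ) :
    P t = P t' := by
  classical
  have hne : ∀ i < 2 * k, P i ≠ P (i + 1) := fun i hi => (hadj i hi).ne
  -- classification of steps
  have hstep : ∀ i < 2 * k,
      (H (i + 1) = H i + 1 ∧ (Stmt16.First P i ∨ ∃ r < i, Stmt16.First P r ∧ P r = P i ∧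
        P (r + 1) = P (i + 1) ∧ ¬ (pathGraph P (2 * k)).IsCycleEdge (Stmt16.E P r))) ∨
      (H (i + 1) = H i - 1 ∧ ∃ s < i, Stmt16.First P s ∧ Stmt16.E P s = Stmt16.E P i ∧
        ((P s = P (i + 1) ∧ P (s + 1) = P i ∧
          ¬ (pathGraph P (2 * k)).IsCycleEdge (Stmt16.E P s)) ∨
          (pathGraph P (2 * k)).IsCycleEdge (Stmt16.E P i))) := by
    intro i hi
    by_cases htr : TraveledBefore P i
    · obtain ⟨r, hr1, hr2, hr3⟩ := Stmt16.exists_first P i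
      have hri : r < i := by
        rcases Nat.eq_or_lt_of_le hr1 with rfl | h
        · obtain ⟨j, hj, h⟩ := htr
          exact absurd h (hr3 j hj)
        · exact h
      by_cases hc : (pathGraph P (2 * k)).IsCycleEdge (Stmt16.E P i)
      · right
        exact ⟨hcyc i hi hc htr, r, hri, hr3, hr2, Or.inr hc⟩
      have huniq : ∀ t₀ < i, s(P t₀, P (t₀ + 1)) = s(P i, P (i + 1)) →
          (∀ t' < t₀, s(P t', P (t' + 1)) ≠ s(P i, P (i + 1))) → t₀ = r := by
        intro t₀ _ h1 h2
        rcases lt_trichotomy t₀ r with h | h | h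
        · exact absurd (h1.trans hr2.symm) (hr3 t₀ h)
        · exact h
        · exact absurd hr2 (h2 r h)
      have hcr : ¬ (pathGraph P (2 * k)).IsCycleEdge (Stmt16.E P r) := by rwa [hr2]
      rcases Sym2.eq_iff.1 hr2 with ⟨h1, h2⟩ | ⟨h1, h2⟩
      · left
        refine ⟨hfwd i hi hc htr ?_, Or.inr ⟨r, hri, hr3, h1, h2, hcr⟩⟩
        intro t₀ a1 a2 a3
        rw [huniq t₀ a1 a2 a3, h1]
      · right
        refine ⟨hbwd i hi hc htr ?_, r, hri, hr3, hr2, Or.inl ⟨h1, h2, hcr⟩⟩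
        intro t₀ a1 a2 a3
        rw [huniq t₀ a1 a2 a3, h1]
    · left
      refine ⟨hnew i hi htr, Or.inl ?_⟩
      intro j hj h
      exact htr ⟨j, hj, h⟩
  have hpm : ∀ i < 2 * k, H (i + 1) = H i + 1 ∨ H (i + 1) = H i - 1 := by
    intro i hi
    rcases hstep i hi with ⟨h, -⟩ | ⟨h, -⟩
    · exact Or.inl h
    · exact Or.inr h
  have key : ∀ n a b, b - a ≤ n → t ≤ a → a ≤ b → b ≤ t' → H a = H b →
      (∀ i, a ≤ i → i ≤ b → H a ≤ H i) → P a = P b := by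
    intro n
    induction n with
    | zero =>
      intro a b h1 h2 h3 _ _ _
      have : a = b := by omega
      rw [this]
    | succ n ih =>
      intro a b hn hta hab hbt hHab hge
      rcases Nat.eq_or_lt_of_le hab with rfl | hlt
      · rfl
      have hup1 : H (a + 1) = H a + 1 := by
        have := hge (a + 1) (by omega) (by omega)
        have := hpm a (by omega)
        omega
      obtain ⟨c, hac, hcb, hHc1, hHc, hin⟩ := Stmt16.first_return H (2 * k) hpm a b hlt
        (by omega) hup1 hHab.ge
      rcases Nat.eq_or_lt_of_le (show c + 1 ≤ b from hcb) with hceq | hclt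
      · rw [← hceq]
        have hv : P (a + 1) = P c := by
          refine ih (a + 1) c (by omega) (by omega) (by omega) (by omega) (by omega) ?_
          intro i h1 h2
          rw [hup1]
          exact hin i (by omega) h2
        have hA : c + 1 ∉ ASet P k H ∪ CSet P k := havoid (c + 1) (by omega) (by omega)
        have hdisc : ¬ DiscoveredBy P c (P c) := by
          intro hd
          apply hA
          left
          refine ⟨by omega, by omega, Or.inl ⟨hd, ?_⟩⟩
          rw [Nat.add_sub_cancel]
          omega
        have hup : Stmt16.First P a ∨ ∃ r < a, Stmt16.First P r ∧ P r = P a ∧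
            P (r + 1) = P (a + 1) ∧ ¬ (pathGraph P (2 * k)).IsCycleEdge (Stmt16.E P r) := by
          rcases hstep a (by omega) with ⟨-, h⟩ | ⟨h, -⟩
          · exact h
          · omega
        obtain ⟨s, hsc, hs, hsE, hd⟩ : ∃ s < c, Stmt16.First P s ∧
            Stmt16.E P s = Stmt16.E P c ∧ ((P s = P (c + 1) ∧ P (s + 1) = P c ∧
            ¬ (pathGraph P (2 * k)).IsCycleEdge (Stmt16.E P s)) ∨
            (pathGraph P (2 * k)).IsCycleEdge (Stmt16.E P c)) := by
          rcases hstep c (by omega) with ⟨h, -⟩ | ⟨-, h⟩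
          · omega
          · exact h
        refine Stmt16.core P (2 * k) hne a c hac (by omega) hv hup hdisc s hsc hs hsE ?_
        rcases hd with hd | hcycle
        · exact Or.inl hd
        right
        have hthree : ∀ i j, i < j → j < c → Stmt16.E P i = Stmt16.E P c →
            Stmt16.E P j = Stmt16.E P c → False := by
          intro i j hij hjc h1 h2
          apply hA
          right
          exact ⟨by omega, by omega, hcycle,
            Or.inr (Stmt16.mult3 P k i j c hij hjc (by omega) h1 h2)⟩
        refine ⟨?_, hthree⟩
        by_contra hsa
        have hups : H (s + 1) = H s + 1 := by
          apply hnew s (by omega)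
          rintro ⟨j, hj, h⟩
          exact hs j hj h
        have hHs := hin s (by omega) (by omega)
        obtain ⟨d, hsd, hdc, hHd1, hHd, hind⟩ := Stmt16.first_return H (2 * k) hpm s c hsc
          (by omega) hups (by omega)
        have e1 : P s = P (d + 1) := by
          refine ih s (d + 1) (by omega) (by omega) (by omega) (by omega) (by omega) ?_
          intro i h1 h2
          rcases Nat.eq_or_lt_of_le h1 with rfl | h1
          · rfl
          rcases Nat.eq_or_lt_of_le h2 with rfl | h2
          · omega
          have := hind i h1 (by omega)
          omega
        have e2 : P (s + 1) = P d := by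
          refine ih (s + 1) d (by omega) (by omega) (by omega) (by omega) (by omega) ?_
          intro i h1 h2
          rw [hups]
          exact hind i (by omega) h2
        refine hthree s d hsd (by omega) hsE ?_
        rw [← hsE, Stmt16.E, Stmt16.E, e1, e2, Sym2.eq_swap]
      · have e1 : P a = P (c + 1) :=
          ih a (c + 1) (by omega) hta (by omega) (by omega) (by omega)
            (fun i h1 h2 => hge i h1 (by omega))
        have e2 : P (c + 1) = P b :=
          ih (c + 1) b (by omega) (by omega) (by omega) (by omega) (by omega)
            (fun i h1 h2 => by rw [hHc1]; exact hge i (by omega) h2)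
        rw [e1, e2]
  exact key (t' - t) t t' le_rfl le_rfl htt'.le le_rfl heq hmin
end

section
/- Let m ∈ ℕ, 0 ≤ u ≤ r ≤ m with u ≥ 2. Then the cardinality of the set H(m,r,u) of admissible diagram-subset pairs satisfies |H(m,r,u)| ≤ (C m/(r−u+1))^{2(r−u+2)} · ∑_{p=u−1}^{⌊m/2⌋} [(u−1)/(2p−u+1)] · C(2p−u+1, p) · 2^{m−2p}, where C > 0 is a universal constant and C(·,·) denotes the binomial coefficient. Moreover, if the set H(m,r,u) is nonempty then 2u ≤ m+1. -/
/-- The class `H(m,r,u)` of diagram/subset pairs: `H : [0,m] → ℤ` (encoded as a function on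
`ℕ` constant after `m`) with `H 0 = 0` and ±1 steps, `B̃ ⊆ [0,m]` of cardinality `r`, with
exactly `u` up-steps leaving points of `B̃`, satisfying the two structural conditions:
low local minima at equal heights are both in or both out of `B̃`, and every nonzero point
of `B̃` is reached by a down-step. -/
def DiagClass (m r u : ℕ) : Set ((ℕ → ℤ) × Finset ℕ) :=
  {P | P.1 0 = 0 ∧ (∀ t, m ≤ t → P.1 (t + 1) = P.1 t) ∧
    (∀ t < m, P.1 (t + 1) = P.1 t + 1 ∨ P.1 (t + 1) = P.1 t - 1) ∧
    (∀ t ∈ P.2, t ≤ m) ∧ P.2.card = r ∧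
    ({t | 1 ≤ t ∧ t ≤ m ∧ (t - 1) ∈ P.2 ∧ P.1 t = P.1 (t - 1) + 1}).ncard = u ∧
    (∀ t' t : ℕ, t' < t → t ≤ m → P.1 t = P.1 t' →
      (∀ T, t' ≤ T → T ≤ t → P.1 t ≤ P.1 T) → (t' ∈ P.2 ↔ t ∈ P.2)) ∧
    (∀ t ∈ P.2, t ≠ 0 → P.1 t = P.1 (t - 1) - 1)}

/-- First-passage counts: number of `±1` walks of length `n` first hitting `0` from `d`. -/
def QQ : ℕ → ℕ → ℕ
  | d, 0 => if d = 0 then 1 else 0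
  | 0, _ + 1 => 0
  | d + 1, n + 1 => QQ (d + 2) n + QQ d n

theorem QQ_ne {n : ℕ} : ∀ {d : ℕ}, QQ d n ≠ 0 → ∃ a, n = 2 * a + d := by
  induction n with
  | zero => intro d h; by_cases hd : d = 0
            · exact ⟨0, by omega⟩
            · simp [QQ, hd] at h
  | succ n ih =>
    intro d h
    cases d with
    | zero => simp [QQ] at h
    | succ d =>
      rw [QQ] at h
      by_cases h1 : QQ (d + 2) n = 0
      · have h2 : QQ d n ≠ 0 := by omega
        obtain ⟨a, ha⟩ := ih h2
        exact ⟨a, by omega⟩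
      · obtain ⟨a, ha⟩ := ih h1
        exact ⟨a + 1, by omega⟩

theorem QQ_big {d n : ℕ} (h : n < d) : QQ d n = 0 := by
  by_contra h'
  obtain ⟨a, ha⟩ := QQ_ne h'
  omega

/-- Hitting time theorem. -/
theorem QQ_formula (n : ℕ) : ∀ a d : ℕ, n = 2 * a + d →
    n * QQ d n = d * n.choose (a + d) := by
  induction n with
  | zero => intro a d h; have : d = 0 := by omega
            subst this; simp
  | succ n ih =>
    intro a d h
    cases d with
    | zero => simp [QQ]
    | succ d =>
      rw [QQ]
      rcases Nat.eq_zero_or_pos n with hn | hn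
      · subst hn
        have h1 : a = 0 := by omega
        have h2 : d = 0 := by omega
        subst h1 h2
        simp [QQ]
      have h2 := ih a d (by omega)
      have hQ : n * QQ (d + 2) n = (d + 2) * n.choose (a + d + 1) := by
        cases a with
        | zero => rw [QQ_big (by omega), Nat.choose_eq_zero_of_lt (by omega)]; simp
        | succ a => rw [ih a (d + 2) (by omega)]; congr 2; omega
      have hc := Nat.choose_succ_right_eq n (a + d)
      have hp : (n + 1).choose (a + (d + 1)) = n.choose (a + d) + n.choose (a + d + 1) := by
        rw [← add_assoc, Nat.choose_succ_succ]
      rw [hp]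
      have hna : n - (a + d) = a := by omega
      rw [hna] at hc
      apply Nat.eq_of_mul_eq_mul_left hn
      have hn' : n = 2 * a + d := by omega
      calc n * ((n + 1) * (QQ (d + 2) n + QQ d n))
          = (n + 1) * (n * QQ (d + 2) n + n * QQ d n) := by ring
        _ = (n + 1) * ((d + 2) * n.choose (a + d + 1) + d * n.choose (a + d)) := by rw [hQ, h2]
        _ = n * ((d + 1) * (n.choose (a + d) + n.choose (a + d + 1))) := by
          generalize n.choose (a + d) = X at *
          generalize n.choose (a + d + 1) = Y at *
          zify at *
          rw [hn']
          linear_combination (2 : ℤ) * hc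

def Ff (k h g : ℕ) : ℕ :=
  if h = 0 then QQ k (g - k) else if k = 0 then 0 else QQ (h - 1 + k) (g - (k - 1))

/-- Words accepted from state `(k, h)` with mask `γ`. -/
def AccW (γ : ℕ → Bool) : ℕ → ℕ → ℕ → ℕ → Finset (List Bool)
  | _, 0, k, h => if k = 0 ∧ h = 0 then {[]} else ∅
  | t, l + 1, k, h =>
    if γ t then
      (if k = 0 then ∅ else (AccW γ (t + 1) l k (h + 1)).image (List.cons true)) ∪
      (if h = 0 ∨ k = 0 then ∅ else
        (AccW γ (t + 1) l (if h = 1 then k - 1 else k) (h - 1)).image (List.cons false))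
    else (AccW γ (t + 1) l k h).image (List.cons true) ∪
      (AccW γ (t + 1) l k h).image (List.cons false)

def gd (γ : ℕ → Bool) : ℕ → ℕ → ℕ
  | _, 0 => 0
  | t, l + 1 => (if γ t then 1 else 0) + gd γ (t + 1) l

theorem gd_le (γ : ℕ → Bool) (l : ℕ) : ∀ t, gd γ t l ≤ l := by
  induction l with
  | zero => intro t; simp [gd]
  | succ l ih => intro t; rw [gd]; have := ih (t + 1); split_ifs <;> omega

theorem QQ_step (d g k : ℕ) (hk : 1 ≤ k) (hd : k ≤ d + 1) :
    QQ (d + 2) (g - (k - 1)) + QQ d (g - (k - 1)) ≤ QQ (d + 1) (g + 1 - (k - 1)) := by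
  by_cases h : k - 1 ≤ g
  · have : g + 1 - (k - 1) = (g - (k - 1)) + 1 := by omega
    rw [this, QQ]
  · rw [QQ_big (by omega), QQ_big (by omega)]; simp

theorem Acc_card (γ : ℕ → Bool) (l : ℕ) : ∀ t k h,
    (AccW γ t l k h).card ≤ 2 ^ (l - gd γ t l) * Ff k h (gd γ t l) := by
  induction l with
  | zero =>
    intro t k h
    rw [AccW]
    split_ifs with hh
    · obtain ⟨rfl, rfl⟩ := hh
      simp [gd, Ff, QQ]
    · simp
  | succ l ih =>
    intro t k h
    rw [AccW, gd]
    have hg := gd_le γ l (t + 1)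
    have ih := ih (t + 1)
    generalize gd γ (t + 1) l = g at *
    by_cases hγ : γ t
    · simp only [hγ, if_true]
      have e1 : l + 1 - (1 + g) = l - g := by omega
      rw [e1]
      by_cases hk : k = 0
      · simp [hk]
      · simp only [hk, if_false, or_false]
        refine (Finset.card_union_le _ _).trans ?_
        by_cases hh : h = 0
        · subst hh
          simp only [if_true, Finset.card_empty, add_zero]
          refine (Finset.card_image_le).trans ((ih _ _).trans ?_)
          apply Nat.mul_le_mul_left
          simp only [Ff, hk]
          simp
          have : 1 + g - k = g - (k - 1) := by omega
          rw [this]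
        · simp only [hh, if_false]
          refine (add_le_add (Finset.card_image_le.trans (ih _ _))
            (Finset.card_image_le.trans (ih _ _))).trans ?_
          rw [← Nat.mul_add]
          apply Nat.mul_le_mul_left
          by_cases h1 : h = 1
          · subst h1
            simp only [Ff, hk]
            simp
            have := QQ_step (k - 1) g k (by omega) (by omega)
            have e2 : k - 1 + 2 = 1 + k := by omega
            have e3 : k - 1 + 1 = k := by omega
            rw [e2, e3, add_comm g 1] at this
            exact this
          · have h2 : h - 1 ≠ 0 := by omega
            simp only [Ff, hk, h1, hh, h2]
            simp
            have := QQ_step (h - 2 + k) g k (by omega) (by omega)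
            have e2 : h - 2 + k + 2 = h + k := by omega
            have e3 : h - 2 + k + 1 = h - 1 + k := by omega
            have e4 : h - 1 - 1 + k = h - 2 + k := by omega
            rw [e2, e3, add_comm g 1] at this
            rw [e4, if_neg hk]
            exact this
    · simp only [hγ]
      simp only [Bool.false_eq_true, if_false, zero_add]
      refine (Finset.card_union_le _ _).trans ?_
      refine (add_le_add (Finset.card_image_le.trans (ih _ _))
            (Finset.card_image_le.trans (ih _ _))).trans ?_
      have : l + 1 - g = (l - g) + 1 := by omega
      rw [this, pow_succ]
      apply le_of_eq; ring

def word (H : ℕ → ℤ) : ℕ → ℕ → List Bool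
  | _, 0 => []
  | t, l + 1 => decide (H (t + 1) = H t + 1) :: word H (t + 1) l

theorem word_inj {H H' : ℕ → ℤ} (m : ℕ) 
    (s : ∀ t < m, H (t + 1) = H t + 1 ∨ H (t + 1) = H t - 1)
    (s' : ∀ t < m, H' (t + 1) = H' t + 1 ∨ H' (t + 1) = H' t - 1) (l : ℕ) :
    ∀ t, t + l = m → H t = H' t → word H t l = word H' t l → ∀ T, t ≤ T → T ≤ m → H T = H' T := by
  induction l with
  | zero => intro t ht h _ T h1 h2; have : T = t := by omega
            rw [this, h]
  | succ l ih =>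
    intro t ht h hw T h1 h2
    simp only [word, List.cons.injEq, decide_eq_decide] at hw
    have a := s t (by omega)
    have b := s' t (by omega)
    have c := hw.1
    have h3 : H (t + 1) = H' (t + 1) := by
      by_cases hx : H (t + 1) = H t + 1
      · have := c.1 hx; omega
      · have : ¬ _ := fun y => hx (c.2 y)
        omega
    rcases Nat.eq_or_lt_of_le h1 with e | e
    · rw [← e, h]
    · exact ih (t + 1) (by omega) h3 hw.2 T e h2

theorem word_mem {H : ℕ → ℤ} {m : ℕ} (G : Finset ℕ) (N : ℕ → ℕ) (γ : ℕ → Bool)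
    (s : ∀ t < m, H (t + 1) = H t + 1 ∨ H (t + 1) = H t - 1)
    (hN1 : ∀ g ∈ G, g < N g) (hN2 : ∀ g ∈ G, N g ≤ m) (hN3 : ∀ g ∈ G, H (N g) = H g)
    (hN4 : ∀ g ∈ G, ∀ T, g < T → T < N g → H g < H T)
    (hd : ∀ g ∈ G, ∀ g' ∈ G, g < g' → N g ≤ g')
    (hγ : ∀ t, γ t = true ↔ ∃ g ∈ G, g ≤ t ∧ t < N g) (l : ℕ) :
    ∀ (t h : ℕ), t + l = m → (∀ g ∈ G, g ≤ t → t < N g → (h : ℤ) = H t - H g) →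
      ((¬ ∃ g ∈ G, g ≤ t ∧ t < N g) → h = 0) →
      word H t l ∈ AccW γ t l (G.filter (fun g => t < N g)).card h := by
  have huniq : ∀ g ∈ G, ∀ g' ∈ G, ∀ t, g ≤ t → t < N g → g' < g ∨ t < g' ∨ g' = g := by
    intro g hg g' hg' t h1 h2
    rcases lt_trichotomy g' g with h | h | h
    · exact Or.inl h
    · exact Or.inr (Or.inr h)
    · have := hd g hg g' hg' h
      right; left; omega
  induction l with
  | zero =>
    intro t h ht h1 h2
    have hk : (G.filter (fun g => t < N g)) = ∅ := by
      apply Finset.filter_eq_empty_iff.2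
      intro g hg
      have := hN2 g hg
      omega
    have hh : h = 0 := h2 (by
      rintro ⟨g, hg, _, h4⟩
      have := hN2 g hg
      omega)
    simp [AccW, word, hk, hh]
  | succ l ih =>
    intro t h ht h1 h2
    rw [AccW, word]
    by_cases hgood : ∃ g ∈ G, g ≤ t ∧ t < N g
    · rw [if_pos ((hγ t).2 hgood)]
      obtain ⟨g, hg, hgt, htg⟩ := hgood
      have hh := h1 g hg hgt htg
      have hk0 : (G.filter (fun g => t < N g)).card ≠ 0 := by
        rw [Finset.card_ne_zero]
        exact ⟨g, by simp [hg, htg]⟩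
      have hst := s t (by omega)
      by_cases hlast : t + 1 < N g
      · have hkk : (G.filter (fun g => t < N g)) = (G.filter (fun g => t + 1 < N g)) := by
          apply Finset.filter_congr
          intro g' hg'
          constructor
          · intro h5
            by_contra h6
            have h7 : N g' = t + 1 := by omega
            have h8 := hN1 g' hg'
            rcases lt_trichotomy g' g with h9 | h9 | h9
            · have := hd g' hg' g hg h9; omega
            · subst h9; omega
            · have := hd g hg g' hg' h9; omega
          · intro h5; omega
        have hpos := hN4 g hg (t + 1) (by omega) hlast
        have key : ∀ h' : ℕ, (h' : ℤ) = H (t + 1) - H g →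
            word H (t + 1) l ∈ AccW γ (t + 1) l (G.filter (fun g => t < N g)).card h' := by
          intro h' hh'
          rw [hkk]
          apply ih (t + 1) h' (by omega)
          · intro g' hg' h5 h6
            rcases huniq g hg g' hg' (t + 1) (by omega) hlast with h9 | h9 | h9
            · have := hd g' hg' g hg h9; omega
            · omega
            · subst h9; exact hh'
          · intro h5
            exact absurd ⟨g, hg, by omega, hlast⟩ h5
        rcases hst with hst | hst
        · rw [if_neg hk0]
          apply Finset.mem_union_left
          have : decide (H (t + 1) = H t + 1) = true := by simpa using hst
          rw [this]
          exact Finset.mem_image_of_mem _ (key (h + 1) (by push_cast; omega))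
        · apply Finset.mem_union_right
          have : decide (H (t + 1) = H t + 1) = false := by simp; omega
          rw [this, if_neg (by omega), if_neg (by omega)]
          exact Finset.mem_image_of_mem _ (key (h - 1) (by omega))
      · have hNe : N g = t + 1 := by omega
        have hHe := hN3 g hg
        rw [hNe] at hHe
        have hgt' : g ≠ t := by
          intro h5; subst h5; omega
        have hpos := hN4 g hg t (by omega) htg
        have hkk : (G.filter (fun g => t + 1 < N g)) = (G.filter (fun g => t < N g)).erase g := by
          ext g'
          simp only [Finset.mem_filter, Finset.mem_erase]
          constructor
          · rintro ⟨h5, h6⟩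
            refine ⟨?_, h5, by omega⟩
            rintro rfl; omega
          · rintro ⟨h5, h6, h7⟩
            refine ⟨h6, ?_⟩
            rcases huniq g hg g' h6 t hgt htg with h9 | h9 | h9
            · have := hd g' h6 g hg h9; omega
            · have := hN1 g' h6; omega
            · exact absurd h9 h5
        have hkc : (G.filter (fun g => t + 1 < N g)).card = (G.filter (fun g => t < N g)).card - 1 := by
          rw [hkk, Finset.card_erase_of_mem (by simp [hg, htg])]
        apply Finset.mem_union_right
        have : decide (H (t + 1) = H t + 1) = false := by simp; omega
        rw [this, if_neg (by omega), if_pos (by omega)]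
        apply Finset.mem_image_of_mem
        rw [← hkc]
        have hz : h - 1 = 0 := by omega
        rw [hz]
        apply ih (t + 1) 0 (by omega)
        · intro g' hg' h5 h6
          rcases huniq g hg g' hg' t hgt htg with h9 | h9 | h9
          · have := hd g' hg' g hg h9; omega
          · have : g' = t + 1 := by omega
            rw [this]; simp
          · subst h9; omega
        · intro _; rfl
    · have hz := h2 hgood
      subst hz
      rw [if_neg (by rw [hγ t]; exact hgood)]
      have hkk : (G.filter (fun g => t < N g)) = (G.filter (fun g => t + 1 < N g)) := by
        apply Finset.filter_congr
        intro g' hg'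
        constructor
        · intro h5
          by_contra h6
          have h8 := hN1 g' hg'
          exact hgood ⟨g', hg', by omega, h5⟩
        · intro h5; omega
      have key : word H (t + 1) l ∈ AccW γ (t + 1) l (G.filter (fun g => t < N g)).card 0 := by
        rw [hkk]
        apply ih (t + 1) 0 (by omega)
        · intro g' hg' h5 h6
          have : g' = t + 1 := by
            by_contra h7
            exact hgood ⟨g', hg', by omega, by omega⟩
          rw [this]; simp
        · intro _; rfl
      cases decide (H (t + 1) = H t + 1)
      · exact Finset.mem_union_right _ (Finset.mem_image_of_mem _ key)
      · exact Finset.mem_union_left _ (Finset.mem_image_of_mem _ key)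

/-- The mask determined by the start set `S` and the end set `E` of the free segments. -/
def maskSE (S E : Finset ℕ) (t : ℕ) : Bool :=
  decide ((S.filter (· ≤ t)).card < (E.filter (· ≤ t)).card)

open Classical in
/-- Reconstruction of the marked set. -/
noncomputable def recB (m : ℕ) (H : ℕ → ℤ) (E : Finset ℕ) : Finset ℕ :=
  (Finset.range (m + 1)).filter (fun t => ∃ e ∈ E, e ≤ t ∧ H t = H e ∧
    ∀ T, e ≤ T → T ≤ t → H t ≤ H T)

theorem heights_anti {m r u : ℕ} {P : (ℕ → ℤ) × Finset ℕ} (hP : P ∈ DiagClass m r u)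
    {a b : ℕ} (ha : a ∈ P.2) (hb : b ∈ P.2) (hab : a < b) : P.1 b ≤ P.1 a := by
  obtain ⟨h0, hc, hs, hm, hr, hu, hcl, hdn⟩ := hP
  by_contra hlt
  push Not at hlt
  have hbm := hm b hb
  set s := Nat.findGreatest (fun s => P.1 s < P.1 b) b with hsdef
  have hs1 : P.1 s < P.1 b := Nat.findGreatest_spec (P := fun s => P.1 s < P.1 b) hab.le hlt
  have hs2 : s ≤ b := Nat.findGreatest_le b
  have hs3 : ∀ T, s < T → T ≤ b → P.1 b ≤ P.1 T := by
    intro T h1 h2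
    have := Nat.findGreatest_is_greatest (P := fun s => P.1 s < P.1 b) h1 h2
    simpa using this
  have hsb : s < b := by
    rcases Nat.eq_or_lt_of_le hs2 with h | h
    · rw [h] at hs1; exact absurd hs1 (lt_irrefl _)
    · exact h
  have hst := hs s (by omega)
  have h1 := hs3 (s + 1) (by omega) (by omega)
  have hmem : s + 1 ∈ P.2 := by
    rcases Nat.eq_or_lt_of_le (show s + 1 ≤ b from hsb) with h | h
    · rw [h]; exact hb
    · refine (hcl (s + 1) b h hbm (by omega) ?_).2 hb
      intro T h2 h3
      exact hs3 T (by omega) h3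
  have := hdn (s + 1) hmem (by omega)
  simp at this
  omega

theorem two_u {m r u : ℕ} (hne : (DiagClass m r u).Nonempty) : 2 * u ≤ m + 1 := by
  obtain ⟨P, h0, hc, hs, hm, hr, hu, hcl, hdn⟩ := hne
  set A := (Finset.range m).filter (fun t => t ∈ P.2 ∧ P.1 (t + 1) = P.1 t + 1) with hA
  have hAu : A.card = u := by
    rw [← hu, ← Set.ncard_coe_finset, ← Set.ncard_image_of_injective _ (add_left_injective 1)]
    congr 1
    ext t
    simp only [Set.mem_image, Set.mem_setOf_eq, hA, Finset.coe_filter, Finset.mem_range]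
    constructor
    · rintro ⟨s, ⟨h1, h2, h3⟩, rfl⟩
      exact ⟨by omega, by omega, by simpa using h2, by simpa using h3⟩
    · rintro ⟨h1, h2, h3, h4⟩
      have e : t - 1 + 1 = t := by omega
      exact ⟨t - 1, ⟨by omega, h3, by rw [e]; exact h4⟩, e⟩
  have hdisj : Disjoint A ((A.erase 0).image (fun t => t - 1)) := by
    rw [Finset.disjoint_left]
    intro t ht ht'
    obtain ⟨x, hx, rfl⟩ := Finset.mem_image.1 ht'
    simp only [hA, Finset.mem_filter, Finset.mem_erase, Finset.mem_range] at ht hx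
    have h1 := hdn x hx.2.2.1 hx.1
    have e : x - 1 + 1 = x := by omega
    rw [e] at ht
    omega
  have hcard : ((A.erase 0).image (fun t => t - 1)).card = (A.erase 0).card := by
    apply Finset.card_image_of_injOn
    intro x hx y hy hxy
    simp at hx hy hxy
    omega
  have h2 : A.card - 1 ≤ (A.erase 0).card := Finset.pred_card_le_card_erase
  have h3 : (A ∪ ((A.erase 0).image (fun t => t - 1))).card ≤ m := by
    conv_rhs => rw [← Finset.card_range m]
    apply Finset.card_le_card
    intro t ht
    rcases Finset.mem_union.1 ht with h | h
    · exact (Finset.mem_filter.1 h).1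
    · obtain ⟨x, hx, rfl⟩ := Finset.mem_image.1 h
      simp only [hA, Finset.mem_filter, Finset.mem_erase, Finset.mem_range] at hx ⊢
      omega
  rw [Finset.card_union_of_disjoint hdisj] at h3
  omega

theorem exists_code {m r u : ℕ} (hur : u ≤ r) (hu2 : 2 ≤ u) {P : (ℕ → ℤ) × Finset ℕ}
    (hP : P ∈ DiagClass m r u) :
    ∃ S ∈ Finset.powersetCard (r - u + 1) (Finset.range (m + 1)),
    ∃ E ∈ Finset.powersetCard (r - u + 1) (Finset.range (m + 1)),
      word P.1 0 m ∈ AccW (maskSE S E) 0 m (u - 1) 0 ∧ P.2 = recB m P.1 E := by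
  classical
  have hanti := @heights_anti m r u P hP
  obtain ⟨h0, hc, hs, hm, hr, hu, hcl, hdn⟩ := hP
  set A := (Finset.range m).filter (fun t => t ∈ P.2 ∧ P.1 (t + 1) = P.1 t + 1) with hA
  have hAu : A.card = u := by
    rw [← hu, ← Set.ncard_coe_finset, ← Set.ncard_image_of_injective _ (add_left_injective 1)]
    congr 1
    ext t
    simp only [Set.mem_image, Set.mem_setOf_eq, hA, Finset.coe_filter, Finset.mem_range]
    constructor
    · rintro ⟨s, ⟨h1, h2, h3⟩, rfl⟩
      exact ⟨by omega, by omega, by simpa using h2, by simpa using h3⟩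
    · rintro ⟨h1, h2, h3, h4⟩
      have e : t - 1 + 1 = t := by omega
      exact ⟨t - 1, ⟨by omega, h3, by rw [e]; exact h4⟩, e⟩
  let R : ℕ → Prop := fun t => ∃ T, t < T ∧ T ≤ m ∧ P.1 T ≤ P.1 t
  have hnr : (A.filter (fun t => ¬ R t)).card ≤ 1 := by
    rw [Finset.card_le_one]
    have main : ∀ a ∈ A.filter (fun t => ¬ R t), ∀ b ∈ A.filter (fun t => ¬ R t), ¬ a < b := by
      intro a ha b hb hab
      simp only [hA, Finset.mem_filter, Finset.mem_range] at ha hb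
      exact ha.2 ⟨b, hab, by omega, hanti ha.1.2.1 hb.1.2.1 hab⟩
    intro a ha b hb
    have h1 := main a ha b hb
    have h2 := main b hb a ha
    omega
  have hR : u - 1 ≤ (A.filter R).card := by
    have := Finset.card_filter_add_card_filter_not (s := A) R
    omega
  obtain ⟨G, hGA, hGc⟩ := Finset.exists_subset_card_eq hR
  have hG : ∀ g ∈ G, g < m ∧ g ∈ P.2 ∧ P.1 (g + 1) = P.1 g + 1 ∧ R g := by
    intro g hg
    have := hGA hg
    simp only [hA, Finset.mem_filter, Finset.mem_range] at this
    exact ⟨this.1.1, this.1.2.1, this.1.2.2, this.2⟩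
  let N : ℕ → ℕ := fun g => if h : R g then Nat.find h else 0
  have hNspec : ∀ g ∈ G, (g < N g ∧ N g ≤ m ∧ P.1 (N g) ≤ P.1 g) ∧
      ∀ T, g < T → T < N g → P.1 g < P.1 T := by
    intro g hg
    have hRg := (hG g hg).2.2.2
    have e : N g = Nat.find hRg := by simp only [N, dif_pos hRg]
    rw [e]
    have hsp := Nat.find_spec hRg
    refine ⟨hsp, ?_⟩
    intro T h1 h2
    have h3 := Nat.find_min hRg h2
    by_contra h4
    exact h3 ⟨h1, by omega, by omega⟩
  have hN1 : ∀ g ∈ G, g < N g := fun g hg => (hNspec g hg).1.1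
  have hN2 : ∀ g ∈ G, N g ≤ m := fun g hg => (hNspec g hg).1.2.1
  have hN4 : ∀ g ∈ G, ∀ T, g < T → T < N g → P.1 g < P.1 T := fun g hg => (hNspec g hg).2
  have hN3 : ∀ g ∈ G, P.1 (N g) = P.1 g := by
    intro g hg
    have h1 := hN1 g hg
    have h2 := hN2 g hg
    have h3 := (hNspec g hg).1.2.2
    have h4 := (hG g hg).2.2.1
    have h5 := hs (N g - 1) (by omega)
    have e : N g - 1 + 1 = N g := by omega
    rw [e] at h5
    by_cases h6 : N g = g + 1
    · rw [h6] at h3; omega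
    · have := hN4 g hg (N g - 1) (by omega) (by omega)
      omega
  have hNB : ∀ g ∈ G, N g ∈ P.2 := by
    intro g hg
    refine (hcl g (N g) (hN1 g hg) (hN2 g hg) (hN3 g hg) ?_).1 (hG g hg).2.1
    intro T h1 h2
    rw [hN3 g hg]
    rcases Nat.eq_or_lt_of_le h1 with h | h
    · rw [h]
    rcases Nat.eq_or_lt_of_le h2 with h' | h'
    · rw [h', hN3 g hg]
    · exact (hN4 g hg T h h').le
  have hd : ∀ g ∈ G, ∀ g' ∈ G, g < g' → N g ≤ g' := by
    intro g hg g' hg' hlt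
    by_contra h1
    have h2 := hanti (hG g hg).2.1 (hG g' hg').2.1 hlt
    have h3 := hN4 g hg g' hlt (by omega)
    omega
  have hinj : Set.InjOn N G := by
    intro a ha b hb hab
    have ha' : a ∈ G := ha
    have hb' : b ∈ G := hb
    rcases lt_trichotomy a b with h | h | h
    · have h1 := hd a ha' b hb' h
      have h2 := hN1 b hb'
      omega
    · exact h
    · have h1 := hd b hb' a ha' h
      have h2 := hN1 a ha'
      omega
  have hGB : G ⊆ P.2 := fun g hg => (hG g hg).2.1
  have hNGB : G.image N ⊆ P.2 := by
    intro x hx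
    obtain ⟨g, hg, rfl⟩ := Finset.mem_image.1 hx
    exact hNB g hg
  have hNc : (G.image N).card = u - 1 := by rw [Finset.card_image_of_injOn hinj, hGc]
  have hBm : P.2 ⊆ Finset.range (m + 1) := by
    intro t ht
    have := hm t ht
    simp; omega
  refine ⟨P.2 \ G, ?_, P.2 \ G.image N, ?_, ?_, ?_⟩
  · rw [Finset.mem_powersetCard]
    refine ⟨Finset.sdiff_subset.trans hBm, ?_⟩
    rw [Finset.card_sdiff_of_subset hGB]; omega
  · rw [Finset.mem_powersetCard]
    refine ⟨Finset.sdiff_subset.trans hBm, ?_⟩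
    rw [Finset.card_sdiff_of_subset hNGB]; omega
  · have hmask : ∀ t, maskSE (P.2 \ G) (P.2 \ G.image N) t = true ↔
        ∃ g ∈ G, g ≤ t ∧ t < N g := by
      intro t
      have e1 : ((P.2 \ G).filter (· ≤ t)).card + (G.filter (· ≤ t)).card
          = (P.2.filter (· ≤ t)).card := by
        rw [← Finset.card_union_of_disjoint, ← Finset.filter_union, Finset.sdiff_union_of_subset hGB]
        exact Finset.disjoint_filter_filter Finset.sdiff_disjoint
      have e2 : ((P.2 \ G.image N).filter (· ≤ t)).card + ((G.image N).filter (· ≤ t)).card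
          = (P.2.filter (· ≤ t)).card := by
        rw [← Finset.card_union_of_disjoint, ← Finset.filter_union,
          Finset.sdiff_union_of_subset hNGB]
        exact Finset.disjoint_filter_filter Finset.sdiff_disjoint
      have e3 : ((G.image N).filter (· ≤ t)).card = (G.filter (fun g => N g ≤ t)).card := by
        rw [Finset.filter_image, Finset.card_image_of_injOn]
        exact hinj.mono (by intro x hx; exact (Finset.mem_filter.1 hx).1)
      have hsub : G.filter (fun g => N g ≤ t) ⊆ G.filter (· ≤ t) := by
        intro g hg
        simp only [Finset.mem_filter] at hg ⊢
        have := hN1 g hg.1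
        exact ⟨hg.1, by omega⟩
      rw [maskSE, decide_eq_true_iff]
      constructor
      · intro hlt
        have : (G.filter (fun g => N g ≤ t)).card < (G.filter (· ≤ t)).card := by omega
        obtain ⟨g, hg1, hg2⟩ := Finset.exists_mem_notMem_of_card_lt_card this
        simp only [Finset.mem_filter] at hg1 hg2
        refine ⟨g, hg1.1, hg1.2, ?_⟩
        by_contra h
        exact hg2 ⟨hg1.1, by omega⟩
      · rintro ⟨g, hg, h1, h2⟩
        have : (G.filter (fun g => N g ≤ t)).card < (G.filter (· ≤ t)).card := by
          apply Finset.card_lt_card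
          refine ⟨hsub, fun h => ?_⟩
          have h3 := h (Finset.mem_filter.2 ⟨hg, h1⟩)
          have := (Finset.mem_filter.1 h3).2
          omega
        omega
    have hw := word_mem G N _ hs hN1 hN2 hN3 hN4 hd hmask m 0 0 (by omega) (by
      intro g hg h1 h2
      have : g = 0 := by omega
      simp [this]) (fun _ => rfl)
    have e : G.filter (fun g => 0 < N g) = G := by
      apply Finset.filter_true_of_mem
      intro g hg
      have := hN1 g hg
      omega
    rw [e, hGc] at hw
    exact hw
  · ext t
    simp only [recB, Finset.mem_filter, Finset.mem_range]
    constructor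
    · intro ht
      refine ⟨by have := hm t ht; omega, ?_⟩
      induction t using Nat.strong_induction_on with
      | _ t ih =>
        by_cases htN : t ∈ G.image N
        · obtain ⟨g, hg, rfl⟩ := Finset.mem_image.1 htN
          obtain ⟨e, he, h1, h2, h3⟩ := ih g (hN1 g hg) (hG g hg).2.1
          have h4 := hN1 g hg
          have h5 := hN3 g hg
          refine ⟨e, he, by omega, by omega, ?_⟩
          intro T h6 h7
          rcases Nat.lt_or_ge g T with h8 | h8
          · rcases Nat.eq_or_lt_of_le h7 with h9 | h9
            · rw [h9]
            · have := hN4 g hg T h8 h9; omega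
          · have := h3 T h6 h8; omega
        · refine ⟨t, Finset.mem_sdiff.2 ⟨ht, htN⟩, le_refl _, rfl, ?_⟩
          intro T h1 h2
          have : T = t := by omega
          rw [this]
    · rintro ⟨h1, e, he, h2, h3, h4⟩
      have heB := (Finset.mem_sdiff.1 he).1
      rcases Nat.eq_or_lt_of_le h2 with h5 | h5
      · rw [← h5]; exact heB
      · exact (hcl e t h5 (by omega) h3 h4).1 heB

theorem word_count (γ : ℕ → Bool) (m u : ℕ) (hu : 2 ≤ u) :
    ((AccW γ 0 m (u - 1) 0).card : ℝ) ≤ ∑ p ∈ Finset.Icc (u - 1) (m / 2),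
            (((u - 1 : ℕ) : ℝ) / ((2 * p - u + 1 : ℕ) : ℝ)) *
              ((2 * p - u + 1).choose p : ℝ) * (2 : ℝ) ^ (m - 2 * p) := by
  have h1 := Acc_card γ m 0 (u - 1) 0
  have hg := gd_le γ m 0
  generalize gd γ 0 m = g at *
  have hF : Ff (u - 1) 0 g = QQ (u - 1) (g - (u - 1)) := by simp [Ff]
  rw [hF] at h1
  have hnn : ∀ p ∈ Finset.Icc (u - 1) (m / 2), (0 : ℝ) ≤
      (((u - 1 : ℕ) : ℝ) / ((2 * p - u + 1 : ℕ) : ℝ)) *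
              ((2 * p - u + 1).choose p : ℝ) * (2 : ℝ) ^ (m - 2 * p) := by
    intro p _; positivity
  by_cases hQ : QQ (u - 1) (g - (u - 1)) = 0
  · rw [hQ] at h1
    have : (AccW γ 0 m (u - 1) 0).card = 0 := by omega
    rw [this]
    simpa using Finset.sum_nonneg hnn
  · obtain ⟨a, ha⟩ := QQ_ne hQ
    have hgp : g = 2 * (a + (u - 1)) := by omega
    have hf := QQ_formula _ a (u - 1) ha
    set p := a + (u - 1) with hp
    have hpm : p ∈ Finset.Icc (u - 1) (m / 2) := by
      rw [Finset.mem_Icc]; omega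
    refine le_trans ?_ (Finset.single_le_sum hnn hpm)
    have e : g - (u - 1) = 2 * p - u + 1 := by omega
    rw [e] at hf h1
    have hpos : (0 : ℝ) < ((2 * p - u + 1 : ℕ) : ℝ) := by positivity
    have hf' : ((2 * p - u + 1 : ℕ) : ℝ) * (QQ (u - 1) (2 * p - u + 1) : ℝ)
        = ((u - 1 : ℕ) : ℝ) * ((2 * p - u + 1).choose p : ℝ) := by exact_mod_cast hf
    have h1' : ((AccW γ 0 m (u - 1) 0).card : ℝ) ≤
        (2 : ℝ) ^ (m - g) * (QQ (u - 1) (2 * p - u + 1) : ℝ) := by exact_mod_cast h1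
    refine h1'.trans (le_of_eq ?_)
    rw [div_mul_eq_mul_div, ← hf', hgp]
    field_simp

theorem choose_bound (m n : ℕ) (hn : 1 ≤ n) (hnm : n ≤ m) :
    ((m + 1).choose n : ℝ) * ((m + 1).choose n : ℝ) ≤
      (2 * Real.exp 1 * m / (n : ℝ)) ^ (2 * (n + 1)) := by
  have hn0 : (0 : ℝ) < n := by exact_mod_cast hn
  have hm1 : (1 : ℝ) ≤ m := by exact_mod_cast hn.trans hnm
  have hnm' : (n : ℝ) ≤ m := by exact_mod_cast hnm
  have hx : (1 : ℝ) ≤ 2 * Real.exp 1 * m / (n : ℝ) := by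
    rw [le_div_iff₀ hn0]
    have := Real.add_one_le_exp 1
    nlinarith
  have h1 : ((m + 1).choose n : ℝ) ≤ (2 * Real.exp 1 * m / (n : ℝ)) ^ n := by
    have a := Nat.choose_le_pow_div (α := ℝ) n (m + 1)
    have b := Real.pow_div_factorial_le_exp (n : ℝ) hn0.le n
    have hf : (0 : ℝ) < (n.factorial : ℝ) := by exact_mod_cast n.factorial_pos
    have c : 1 / (n.factorial : ℝ) ≤ (Real.exp 1 / n) ^ n := by
      rw [div_pow, ← Real.exp_nat_mul, mul_one, le_div_iff₀ (by positivity)]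
      calc _ = (n : ℝ) ^ n / (n.factorial : ℝ) := by ring
        _ ≤ _ := b
    calc ((m + 1).choose n : ℝ) ≤ ((m + 1 : ℕ) : ℝ) ^ n / (n.factorial : ℝ) := a
      _ = ((m + 1 : ℕ) : ℝ) ^ n * (1 / (n.factorial : ℝ)) := by ring
      _ ≤ (2 * (m : ℝ)) ^ n * (Real.exp 1 / n) ^ n := by
        gcongr
        push_cast; linarith
      _ = _ := by rw [← mul_pow]; congr 1; ring
  calc _ ≤ (2 * Real.exp 1 * m / (n : ℝ)) ^ n * (2 * Real.exp 1 * m / (n : ℝ)) ^ n := by gcongr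
    _ = (2 * Real.exp 1 * m / (n : ℝ)) ^ (2 * n) := by rw [← pow_add]; congr 1; omega
    _ ≤ _ := pow_le_pow_right₀ hx (by omega)

theorem card_bound {m r u : ℕ} (hur : u ≤ r) (hu2 : 2 ≤ u) (R : ℝ)
    (hR : ∀ γ, ((AccW γ 0 m (u - 1) 0).card : ℝ) ≤ R) :
    (Nat.card (DiagClass m r u) : ℝ) ≤
      ((m + 1).choose (r - u + 1) : ℝ) * ((m + 1).choose (r - u + 1) : ℝ) * R := by
  classical
  set D := Finset.powersetCard (r - u + 1) (Finset.range (m + 1)) with hD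
  let T : Finset (Σ _ : Finset ℕ × Finset ℕ, List Bool) :=
    (D ×ˢ D).sigma (fun q => AccW (maskSE q.1 q.2) 0 m (u - 1) 0)
  have hex : ∀ P : DiagClass m r u, ∃ x : T, x.1.2 = word P.1.1 0 m ∧
      P.1.2 = recB m P.1.1 x.1.1.2 := by
    rintro ⟨P, hP⟩
    obtain ⟨S, hS, E, hE, hw, hB⟩ := exists_code hur hu2 hP
    exact ⟨⟨⟨(S, E), word P.1 0 m⟩, Finset.mem_sigma.2 ⟨Finset.mem_product.2 ⟨hS, hE⟩, hw⟩⟩, rfl, hB⟩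
  choose f hf1 hf2 using hex
  have hinj : Function.Injective f := by
    rintro ⟨P, hP⟩ ⟨P', hP'⟩ h
    have a := hf1 ⟨P, hP⟩
    have a' := hf1 ⟨P', hP'⟩
    have b := hf2 ⟨P, hP⟩
    have b' := hf2 ⟨P', hP'⟩
    rw [h] at a b
    have hw : word P.1 0 m = word P'.1 0 m := a.symm.trans a'
    have hin := word_inj m hP.2.2.1 hP'.2.2.1 m 0 (by omega) (by rw [hP.1, hP'.1]) hw
    have hH : P.1 = P'.1 := by
      funext t
      rcases Nat.le_total t m with h1 | h1
      · exact hin t (by omega) h1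
      · induction t, h1 using Nat.le_induction with
        | base => exact hin m (by omega) le_rfl
        | succ t ht ih => rw [hP.2.1 t ht, hP'.2.1 t ht, ih]
    have hB : P.2 = P'.2 := by
      simp only at b b'
      rw [b, b', hH]
    exact Subtype.ext (Prod.ext hH hB)
  have hc := Nat.card_le_card_of_injective f hinj
  rw [Nat.card_eq_fintype_card (α := T), Fintype.card_coe, Finset.card_sigma] at hc
  calc (Nat.card (DiagClass m r u) : ℝ) ≤
      ∑ q ∈ D ×ˢ D, ((AccW (maskSE q.1 q.2) 0 m (u - 1) 0).card : ℝ) := by exact_mod_cast hc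
    _ ≤ ∑ q ∈ D ×ˢ D, R := Finset.sum_le_sum (fun q _ => hR _)
    _ = _ := by
      rw [Finset.sum_const, Finset.card_product, hD, Finset.card_powersetCard, Finset.card_range]
      simp

/-- There is a universal constant `C > 0` such that for `2 ≤ u ≤ r ≤ m`,
`|H(m,r,u)| ≤ (Cm/(r−u+1))^{2(r−u+2)} · ∑_{p=u−1}^{⌊m/2⌋} ((u−1)/(2p−u+1)) C(2p−u+1,p) 2^{m−2p}`.
Moreover, whenever `H(m,r,u)` is nonempty, `2u ≤ m + 1`. -/
theorem stmt_18 : ∃ C : ℝ, 0 < C ∧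
    (∀ m r u : ℕ, u ≤ r → r ≤ m → 2 ≤ u →
      (Nat.card (DiagClass m r u) : ℝ)
        ≤ (C * m / ((r - u + 1 : ℕ) : ℝ)) ^ (2 * (r - u + 2)) *
          ∑ p ∈ Finset.Icc (u - 1) (m / 2),
            (((u - 1 : ℕ) : ℝ) / ((2 * p - u + 1 : ℕ) : ℝ)) *
              ((2 * p - u + 1).choose p : ℝ) * (2 : ℝ) ^ (m - 2 * p)) ∧
    (∀ m r u : ℕ, u ≤ r → r ≤ m → (DiagClass m r u).Nonempty → 2 * u ≤ m + 1) := by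
  refine ⟨2 * Real.exp 1, by positivity, ?_, fun m r u _ _ h => two_u h⟩
  intro m r u hur hrm hu
  refine (card_bound hur hu _ (fun γ => word_count γ m u hu)).trans ?_
  apply mul_le_mul_of_nonneg_right
  · exact choose_bound m (r - u + 1) (by omega) (by omega)
  · apply Finset.sum_nonneg
    intro p _
    positivity
end
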